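/- arXiv:math/0401149 — 4 statements merged into one kernel-verified Lean document; each statement's English description precedes it below -/
import Mathlib

section
/- Let K be a compact subset of ℝ^d equipped with an absolutely α-friendly measure μ satisfying a·r^δ ≤ μ(B(x,r)) ≤ b·r^δ for all x ∈ K and all r < r₀ (for some positive constants a, b, δ, r₀). Let ψ : ℝ⁺ → ℝ⁺ be decreasing and let s ≤ δ. If ∑_{r=1}^∞ r^{α(d+1)/d − 1} ψ(r)^{α+s−δ} < ∞, then the s-dimensional Hausdorff measure of K ∩ W(ψ) is zero. -/
open MeasureTheory Metric Set

noncomputable section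

/-- The set of psi-well approximable points in R^d. -/
def WellApprox (d : ℕ) (ψ : ℝ → ℝ) : Set (EuclideanSpace ℝ (Fin d)) :=
  {x | {pq : (Fin d → ℤ) × ℕ | 0 < pq.2 ∧
      ∀ i, |x i - (pq.1 i : ℝ) / (pq.2 : ℝ)| ≤ ψ (pq.2 : ℝ)}.Infinite}

/-- μ is doubling on K with constant D for radii below r₀. -/
def IsDoubling (d : ℕ) (K : Set (EuclideanSpace ℝ (Fin d)))
    (μ : Measure (EuclideanSpace ℝ (Fin d))) (D r₀ : ℝ) : Prop :=
  ∀ x ∈ K, ∀ r : ℝ, 0 < r → r < r₀ →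
    μ (ball x (2 * r)) ≤ ENNReal.ofReal D * μ (ball x r)

/-- μ is absolutely α-decaying on K with constants C, α, r₀. -/
def IsAbsolutelyDecaying (d : ℕ) (K : Set (EuclideanSpace ℝ (Fin d)))
    (μ : Measure (EuclideanSpace ℝ (Fin d))) (C α r₀ : ℝ) : Prop :=
  ∀ L : AffineSubspace ℝ (EuclideanSpace ℝ (Fin d)),
    (L : Set (EuclideanSpace ℝ (Fin d))).Nonempty →
    Module.finrank ℝ L.direction = d - 1 →
    ∀ ε : ℝ, 0 < ε → ∀ x ∈ K, ∀ r : ℝ, 0 < r → r < r₀ →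
      μ (ball x r ∩ Metric.thickening ε (L : Set (EuclideanSpace ℝ (Fin d))))
        ≤ ENNReal.ofReal (C * (ε / r) ^ α) * μ (ball x r)


/-- A family of vectors whose span is everything contains a basis with any index type of the
right cardinality. -/
lemma exists_linearIndependent_of_span_eq_top {ι : Type*} [Fintype ι] [DecidableEq ι]
    (S : Set (ι → ℝ)) (hS : Submodule.span ℝ S = ⊤) :
    ∃ v : ι → ι → ℝ, (∀ i, v i ∈ S) ∧ LinearIndependent ℝ v := by
  obtain ⟨B, hBS, hspan, hli⟩ := exists_linearIndependent ℝ S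
  let e : Module.Basis B ℝ (ι → ℝ) := Module.Basis.mk hli (by
    rw [Subtype.range_coe, hspan, hS])
  let σ : B ≃ ι := e.indexEquiv (Pi.basisFun ℝ ι)
  exact ⟨fun i => (σ.symm i : ι → ℝ), fun i => hBS (σ.symm i).2,
    hli.comp _ σ.symm.injective⟩

/-- The simplex lemma: the rational points with denominator at most `Q` in a sufficiently small
box lie on a common affine hyperplane. -/
lemma exists_functional_const_on_rationals (d : ℕ) (hd : 0 < d) (c : EuclideanSpace ℝ (Fin d))
    (r Q : ℝ) (hr : 0 < r) (h : ((d + 1).factorial : ℝ) * r ^ d * Q ^ (d + 1) < 1) :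
    ∃ (v₀ : EuclideanSpace ℝ (Fin d)) (g : Module.Dual ℝ (EuclideanSpace ℝ (Fin d))), g ≠ 0 ∧
      ∀ (p : Fin d → ℤ) (q : ℕ), 0 < q → (q : ℝ) ≤ Q →
        (∀ j, |(p j : ℝ) / q - c j| ≤ r) →
        g (WithLp.toLp 2 (fun j => (p j : ℝ) / q)) = g v₀ := by
  classical
  let w : (Fin d → ℝ) → (Unit ⊕ Fin d → ℝ) :=
    fun v => Sum.elim (fun _ => r) (fun j => v j - c j)
  let S : Set (Fin d → ℝ) := {v | ∃ (p : Fin d → ℤ) (q : ℕ), 0 < q ∧ (q : ℝ) ≤ Q ∧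
    (∀ j, |(p j : ℝ) / q - c j| ≤ r) ∧ v = fun j => (p j : ℝ) / q}
  have hspan : Submodule.span ℝ (w '' S) ≠ ⊤ := by
    intro htop
    obtain ⟨v, hv, hli⟩ := exists_linearIndependent_of_span_eq_top _ htop
    have hv' : ∀ i, ∃ (p : Fin d → ℤ) (q : ℕ), 0 < q ∧ (q : ℝ) ≤ Q ∧
        (∀ j, |(p j : ℝ) / q - c j| ≤ r) ∧ v i = w (fun j => (p j : ℝ) / q) := by
      intro i
      obtain ⟨x, ⟨p, q, h1, h2, h3, rfl⟩, hx⟩ := hv i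
      exact ⟨p, q, h1, h2, h3, hx.symm⟩
    choose p q hq hqQ hbox hvw using hv'
    have hdet : (Matrix.of v).det ≠ 0 := by
      have := (Matrix.linearIndependent_rows_iff_isUnit (A := Matrix.of v)).1 hli
      exact ((Matrix.isUnit_iff_isUnit_det _).1 this).ne_zero
    have hupper : |(Matrix.of v).det| ≤ ((d + 1).factorial : ℝ) * r ^ (d + 1) := by
      have := Matrix.det_le (A := Matrix.of v) (abv := AbsoluteValue.abs) (x := r) (by
        rintro i (j | j)
        · simp [hvw, w, abs_of_pos hr]
        · simpa [hvw, w] using hbox i j)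
      simpa [add_comm 1 d] using this
    let N : Matrix (Unit ⊕ Fin d) (Unit ⊕ Fin d) ℤ :=
      Matrix.of fun i => Sum.elim (fun _ => (q i : ℤ)) (p i)
    let A : Matrix (Unit ⊕ Fin d) (Unit ⊕ Fin d) ℝ :=
      Matrix.fromBlocks (Matrix.of fun _ _ => r) (Matrix.of fun _ j => - c j) 0 1
    have hA : A.det = r := by
      simp [A]
    have hfac : Matrix.of v =
        Matrix.diagonal (fun i => ((q i : ℝ))⁻¹) * (N.map (Int.castRingHom ℝ) * A) := by
      ext i j
      have hqi : (q i : ℝ) ≠ 0 := by exact_mod_cast (hq i).ne'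
      rw [Matrix.diagonal_mul, Matrix.mul_apply, Fintype.sum_sum_type]
      rcases j with j | j
      · simp [hvw, w, N, A]
        field_simp
      · simp [hvw, w, N, A, Matrix.one_apply]
        field_simp
        ring
    have hN : (1 : ℝ) ≤ |((N.det : ℤ) : ℝ)| := by
      have h0 : N.det ≠ 0 := by
        intro h0
        apply hdet
        rw [hfac, Matrix.det_mul, Matrix.det_mul,
          show (N.map (Int.castRingHom ℝ)).det = ((N.det : ℤ) : ℝ) from
            (RingHom.map_det (Int.castRingHom ℝ) N).symm, h0]
        simp
      exact_mod_cast Int.one_le_abs h0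
    have hdetv : |(Matrix.of v).det| * ∏ i, (q i : ℝ) = |((N.det : ℤ) : ℝ)| * r := by
      have hprod : (∏ i, (q i : ℝ)) ≠ 0 :=
        Finset.prod_ne_zero_iff.2 fun i _ => by exact_mod_cast (hq i).ne'
      have hprod0 : 0 ≤ (∏ i, (q i : ℝ)) := Finset.prod_nonneg fun i _ => Nat.cast_nonneg _
      rw [hfac, Matrix.det_mul, Matrix.det_mul, Matrix.det_diagonal, hA,
        show (N.map (Int.castRingHom ℝ)).det = ((N.det : ℤ) : ℝ) from
          (RingHom.map_det (Int.castRingHom ℝ) N).symm, abs_mul, abs_mul, abs_of_pos hr,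
        Finset.prod_inv_distrib, abs_inv, abs_of_nonneg hprod0]
      field_simp
    have hprodle : ∏ i, (q i : ℝ) ≤ Q ^ (d + 1) := by
      calc ∏ i, (q i : ℝ) ≤ ∏ _i : Unit ⊕ Fin d, Q :=
            Finset.prod_le_prod (fun i _ => Nat.cast_nonneg _) (fun i _ => hqQ i)
        _ = Q ^ (d + 1) := by simp [add_comm 1 d]
    have hQ0 : 0 ≤ Q ^ (d + 1) := le_trans (Finset.prod_nonneg fun i _ => Nat.cast_nonneg _) hprodle
    have key : r ≤ ((d + 1).factorial : ℝ) * r ^ (d + 1) * Q ^ (d + 1) := by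
      calc r ≤ |((N.det : ℤ) : ℝ)| * r := le_mul_of_one_le_left hr.le hN
        _ = |(Matrix.of v).det| * ∏ i, (q i : ℝ) := hdetv.symm
        _ ≤ _ := mul_le_mul hupper hprodle
            (Finset.prod_nonneg fun i _ => Nat.cast_nonneg _) (by positivity)
    have : r * (((d + 1).factorial : ℝ) * r ^ d * Q ^ (d + 1)) < r * 1 :=
      mul_lt_mul_of_pos_left h hr
    rw [pow_succ r d] at key
    nlinarith
  obtain ⟨f, hf0, hf⟩ := Submodule.exists_le_ker_of_lt_top _ hspan.lt_top
  have hfS : ∀ v ∈ S, f (w v) = 0 := fun v hv =>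
    hf (Submodule.subset_span (mem_image_of_mem w hv))
  by_cases hne : S.Nonempty
  · obtain ⟨v₀, hv₀⟩ := hne
    let g : Module.Dual ℝ (EuclideanSpace ℝ (Fin d)) :=
      { toFun := fun v => f (Sum.elim 0 (fun j => v j))
        map_add' := by
          intro x y
          rw [← map_add]
          congr 1
          ext (j | j) <;> simp
        map_smul' := by
          intro t x
          rw [RingHom.id_apply, ← map_smul]
          congr 1
          ext (j | j) <;> simp }
    have hg : ∀ u : Fin d → ℝ, g (WithLp.toLp 2 u) = f (Sum.elim 0 u) := fun u => rfl
    refine ⟨WithLp.toLp 2 v₀, g, ?_, ?_⟩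
    · intro hg0
      apply hf0
      have hz : ∀ u : Fin d → ℝ, f (Sum.elim 0 u) = 0 := fun u => by
        rw [← hg, hg0]; rfl
      have h1 : f (Sum.elim (fun _ => r) (fun _ => 0)) = 0 := by
        have e : (Sum.elim (fun _ => r) (fun _ => 0) : Unit ⊕ Fin d → ℝ) =
            w v₀ - Sum.elim (0 : Unit → ℝ) (fun j => v₀ j - c j) := by
          ext (j | j) <;> simp [w]
        rw [e, map_sub, hfS v₀ hv₀, hz, sub_zero]
      refine LinearMap.ext fun x => ?_
      have e : x = (x (Sum.inl ()) / r) • (Sum.elim (fun _ => r) (fun _ => 0) : Unit ⊕ Fin d → ℝ) +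
          Sum.elim (0 : Unit → ℝ) (fun j => x (Sum.inr j)) := by
        ext (j | j)
        · simp; field_simp
        · simp
      rw [e, map_add, map_smul, h1, hz]
      simp
    · intro p q hq hqQ hbox
      rw [hg, hg, ← sub_eq_zero, ← map_sub]
      have e : (Sum.elim (0 : Unit → ℝ) (fun j => (p j : ℝ) / q) - Sum.elim (0 : Unit → ℝ) v₀ : Unit ⊕ Fin d → ℝ) =
          w (fun j => (p j : ℝ) / q) - w v₀ := by
        ext (j | j) <;> simp [w]
      rw [e, map_sub, hfS v₀ hv₀, hfS _ ⟨p, q, hq, hqQ, hbox, rfl⟩, sub_zero]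
  · refine ⟨0, (EuclideanSpace.proj (𝕜 := ℝ) (⟨0, hd⟩ : Fin d)).toLinearMap, ?_, ?_⟩
    · intro h0
      have := LinearMap.congr_fun h0 (WithLp.toLp 2 (fun _ => (1 : ℝ)))
      simp at this
    · intro p q hq hqQ hbox
      exact absurd ⟨_, p, q, hq, hqQ, hbox, rfl⟩ hne

/-- The simplex lemma in terms of affine subspaces. -/
lemma exists_hyperplane_of_rationals (d : ℕ) (hd : 0 < d) (c : EuclideanSpace ℝ (Fin d))
    (r Q : ℝ) (hr : 0 < r) (h : ((d + 1).factorial : ℝ) * r ^ d * Q ^ (d + 1) < 1) :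
    ∃ L : AffineSubspace ℝ (EuclideanSpace ℝ (Fin d)),
      (L : Set (EuclideanSpace ℝ (Fin d))).Nonempty ∧ Module.finrank ℝ L.direction = d - 1 ∧
      ∀ (p : Fin d → ℤ) (q : ℕ), 0 < q → (q : ℝ) ≤ Q →
        (∀ j, |(p j : ℝ) / q - c j| ≤ r) →
        (WithLp.toLp 2 (fun j => (p j : ℝ) / q) : EuclideanSpace ℝ (Fin d)) ∈ L := by
  obtain ⟨v₀, g, hg, hall⟩ := exists_functional_const_on_rationals d hd c r Q hr h
  refine ⟨AffineSubspace.mk' v₀ (LinearMap.ker g), ⟨v₀, AffineSubspace.self_mem_mk' _ _⟩, ?_, ?_⟩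
  · rw [AffineSubspace.direction_mk']
    have := Module.Dual.finrank_ker_add_one_of_ne_zero hg
    rw [finrank_euclideanSpace_fin] at this
    omega
  · intro p q hq hqQ hbox
    rw [AffineSubspace.mem_mk', LinearMap.mem_ker, vsub_eq_sub, map_sub, hall p q hq hqQ hbox,
      sub_self]

/-- A packing argument: a set all of whose points carry mass at least `m` in balls of radius `ρ`
inside a region of mass at most `M` is covered by at most `M / m` balls of radius `2ρ`. -/
lemma exists_finset_cover_of_measure_ball {X : Type*} [PseudoMetricSpace X] [MeasurableSpace X]
    [OpensMeasurableSpace X] (μ : Measure X) (Y U : Set X) (ρ m M : ℝ) (hρ : 0 < ρ)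
    (hm : 0 < m) (hM : 0 ≤ M)
    (hYU : ∀ y ∈ Y, ball y ρ ⊆ U) (hlow : ∀ y ∈ Y, ENNReal.ofReal m ≤ μ (ball y ρ))
    (hup : μ U ≤ ENNReal.ofReal M) :
    ∃ T : Finset X, (T : Set X) ⊆ Y ∧ Y ⊆ ⋃ t ∈ T, ball t (2 * ρ) ∧ (T.card : ℝ) * m ≤ M := by
  classical
  have hcard : ∀ T : Finset X, (T : Set X) ⊆ Y →
      (T : Set X).Pairwise (fun x y => 2 * ρ ≤ dist x y) → (T.card : ℝ) * m ≤ M := by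
    intro T hTY hT
    have hdisj : (T : Set X).PairwiseDisjoint (fun t => ball t ρ) := by
      intro x hx y hy hxy
      exact ball_disjoint_ball (by linarith [hT hx hy hxy])
    have h1 : ∑ t ∈ T, μ (ball t ρ) ≤ ENNReal.ofReal M := by
      rw [← measure_biUnion_finset hdisj (fun _ _ => measurableSet_ball)]
      exact (measure_mono (iUnion₂_subset fun t ht => hYU t (hTY ht))).trans hup
    have h2 : (T.card : ENNReal) * ENNReal.ofReal m ≤ ENNReal.ofReal M := by
      refine le_trans ?_ h1
      rw [← nsmul_eq_mul]
      exact Finset.card_nsmul_le_sum _ _ _ fun t ht => hlow t (hTY ht)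
    rw [← ENNReal.ofReal_natCast, ← ENNReal.ofReal_mul (Nat.cast_nonneg _)] at h2
    exact (ENNReal.ofReal_le_ofReal_iff hM).1 h2
  let P : ℕ → Prop := fun n => ∃ T : Finset X, (T : Set X) ⊆ Y ∧
    (T : Set X).Pairwise (fun x y => 2 * ρ ≤ dist x y) ∧ T.card = n
  have hP0 : P 0 := ⟨∅, by simp, by simp, rfl⟩
  have hPb : ∀ n, P n → n ≤ ⌊M / m⌋₊ := by
    rintro n ⟨T, h1, h2, rfl⟩
    exact Nat.le_floor ((le_div_iff₀ hm).2 (hcard T h1 h2))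
  obtain ⟨T, hTY, hT, hTn⟩ : P (Nat.findGreatest P ⌊M / m⌋₊) :=
    Nat.findGreatest_spec (Nat.zero_le _) hP0
  refine ⟨T, hTY, ?_, hcard T hTY hT⟩
  intro y hy
  by_contra hcon
  simp only [mem_iUnion, mem_ball, not_exists, not_lt] at hcon
  have hyT : y ∉ T := fun hyT => by
    have := hcon y hyT
    rw [dist_self] at this
    linarith
  have hP : P (T.card + 1) := by
    refine ⟨insert y T, ?_, ?_, Finset.card_insert_of_notMem hyT⟩
    · rw [Finset.coe_insert]
      exact insert_subset hy hTY
    · rw [Finset.coe_insert]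
      refine hT.insert fun t ht _ => ⟨hcon t ht, ?_⟩
      rw [dist_comm]
      exact hcon t ht
  have := Nat.le_findGreatest (hPb _ hP) hP
  omega

/-- The Hausdorff-measure version of the Borel–Cantelli lemma. -/
lemma hausdorffMeasure_eq_zero_of_summable {X : Type*} [MetricSpace X] [MeasurableSpace X]
    [BorelSpace X] (A : Set X) (s : ℝ) (hs : 0 ≤ s) (T : ℕ → Finset X) (ρ : ℕ → ℝ)
    (hρ : ∀ n, 0 ≤ ρ n) (hanti : Antitone ρ) (hlim : Filter.Tendsto ρ Filter.atTop (nhds 0))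
    (hcov : ∀ x ∈ A, ∀ N, ∃ n, N ≤ n ∧ ∃ t ∈ T n, x ∈ ball t (ρ n))
    (hsum : Summable fun n => ((T n).card : ℝ) * ρ n ^ s) : μH[s] A = 0 := by
  have hdiam : ∀ (t : X) (n : ℕ), ediam (ball t (ρ n)) ≤ ENNReal.ofReal (2 * ρ n) := fun t n =>
    ediam_le_of_forall_dist_le fun x hx y hy => by
      have := dist_triangle_right x y t
      rw [mem_ball] at hx hy
      linarith
  have htail : Filter.Tendsto (fun N => ∑' k, ENNReal.ofReal
      (((T (k + N)).card : ℝ) * (2 * ρ (k + N)) ^ s)) Filter.atTop (nhds 0) := by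
    refine ENNReal.tendsto_sum_nat_add
      (fun n => ENNReal.ofReal (((T n).card : ℝ) * (2 * ρ n) ^ s)) ?_
    refine Summable.tsum_ofReal_ne_top ?_
    refine (hsum.mul_left ((2 : ℝ) ^ s)).congr fun n => ?_
    rw [Real.mul_rpow zero_le_two (hρ n)]
    ring
  have hle := Measure.hausdorffMeasure_le_liminf_tsum
    (ι := fun N => Σ k, {t // t ∈ T (k + N)}) s A
    (l := Filter.atTop) (fun N => ENNReal.ofReal (2 * ρ N))
    (by simpa using ENNReal.tendsto_ofReal (hlim.const_mul 2))
    (fun N i => ball (i.2 : X) (ρ (i.1 + N)))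
    (Filter.Eventually.of_forall fun N i => (hdiam _ _).trans (ENNReal.ofReal_le_ofReal (by
      have := hanti (Nat.le_add_left N i.1)
      linarith)))
    (Filter.Eventually.of_forall fun N x hx => by
      obtain ⟨n, hn, t, ht, hxt⟩ := hcov x hx N
      obtain ⟨k, rfl⟩ := Nat.exists_eq_add_of_le' hn
      exact mem_iUnion.2 ⟨⟨k, t, ht⟩, hxt⟩)
  refine le_antisymm (hle.trans ?_) zero_le
  rw [← htail.liminf_eq]
  refine Filter.liminf_le_liminf (Filter.Eventually.of_forall fun N => ?_)
  rw [ENNReal.tsum_sigma (fun k (t : {t // t ∈ T (k + N)}) => ediam (ball (t : X) (ρ (k + N))) ^ s)]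
  refine ENNReal.tsum_le_tsum fun k => ?_
  rw [tsum_fintype]
  have hc : ∀ t : {t // t ∈ T (k + N)}, ediam (ball (t : X) (ρ (k + N))) ^ s ≤
      ENNReal.ofReal ((2 * ρ (k + N)) ^ s) := fun t => by
    rw [← ENNReal.ofReal_rpow_of_nonneg (by linarith [hρ (k + N)]) hs]
    exact ENNReal.rpow_le_rpow (hdiam _ _) hs
  refine (Finset.sum_le_card_nsmul _ _ _ fun t _ => hc t).trans ?_
  rw [nsmul_eq_mul, ENNReal.ofReal_mul (Nat.cast_nonneg _), ENNReal.ofReal_natCast,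
    Finset.card_univ, Fintype.card_coe]

/-- Cauchy condensation for products of a power and a decreasing function. -/
lemma summable_dyadic_of_summable (β γ : ℝ) (hγ : 0 ≤ γ) (ψ : ℝ → ℝ)
    (hpos : ∀ r : ℝ, 0 < r → 0 < ψ r) (hmono : ∀ x y : ℝ, 0 < x → x ≤ y → ψ y ≤ ψ x)
    (hsum : Summable fun n : ℕ => ((n : ℝ) + 1) ^ (β - 1) * ψ ((n : ℝ) + 1) ^ γ) :
    Summable fun n : ℕ => ((2 : ℝ) ^ n) ^ β * ψ ((2 : ℝ) ^ n) ^ γ := by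
  set f : ℕ → ℝ := fun k => (k : ℝ) ^ (β - 1) * ψ k ^ γ with hf
  have hfs : Summable f := by
    rw [← summable_nat_add_iff 1]
    simpa [hf] using hsum
  rw [← summable_nat_add_iff 1]
  set c : ℝ := min 1 (2 ^ (β - 1)) with hc
  have hc0 : 0 < c := lt_min one_pos (by positivity)
  have hterm : ∀ n : ℕ, ((2 : ℝ) ^ (n + 1)) ^ β * ψ ((2 : ℝ) ^ (n + 1)) ^ γ ≤
      (2 ^ β / c) * ∑ k ∈ Finset.Ioc (2 ^ n) (2 ^ (n + 1)), f k := by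
    intro n
    have h1 : ∀ k ∈ Finset.Ioc (2 ^ n) (2 ^ (n + 1)),
        c * ((2 : ℝ) ^ n) ^ (β - 1) * ψ ((2 : ℝ) ^ (n + 1)) ^ γ ≤ f k := by
      intro k hk
      rw [Finset.mem_Ioc] at hk
      have hk1 : (2 : ℝ) ^ n ≤ k := by exact_mod_cast hk.1.le
      have hk2 : (k : ℝ) ≤ 2 ^ (n + 1) := by exact_mod_cast hk.2
      have h2n : (0 : ℝ) < 2 ^ n := by positivity
      have hk0 : (0 : ℝ) < k := h2n.trans_le hk1
      refine mul_le_mul ?_ ?_ (Real.rpow_nonneg (hpos _ (by positivity)).le _) (by positivity)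
      · rcases le_total 0 (β - 1) with h | h
        · calc c * ((2 : ℝ) ^ n) ^ (β - 1) ≤ 1 * ((2 : ℝ) ^ n) ^ (β - 1) := by
                gcongr; exact min_le_left _ _
            _ ≤ (k : ℝ) ^ (β - 1) := by
                rw [one_mul]; exact Real.rpow_le_rpow h2n.le hk1 h
        · calc c * ((2 : ℝ) ^ n) ^ (β - 1) ≤ 2 ^ (β - 1) * ((2 : ℝ) ^ n) ^ (β - 1) := by
                gcongr; exact min_le_right _ _
            _ = ((2 : ℝ) ^ (n + 1)) ^ (β - 1) := by
                rw [← Real.mul_rpow zero_le_two h2n.le, pow_succ']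
            _ ≤ (k : ℝ) ^ (β - 1) := Real.rpow_le_rpow_of_nonpos hk0 hk2 h
      · exact Real.rpow_le_rpow (hpos _ (by positivity)).le (hmono _ _ hk0 hk2) hγ
    have h2 := Finset.card_nsmul_le_sum _ _ _ h1
    rw [Nat.card_Ioc, nsmul_eq_mul, show 2 ^ (n + 1) - 2 ^ n = 2 ^ n by rw [pow_succ]; omega] at h2
    have h3 : ((2 : ℝ) ^ (n + 1)) ^ β = 2 ^ β * (2 ^ n * ((2 : ℝ) ^ n) ^ (β - 1)) := by
      rw [pow_succ', Real.mul_rpow zero_le_two (by positivity),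
        Real.rpow_sub_one (by positivity)]
      field_simp
    rw [h3]
    calc _ = (2 ^ β / c) * (((2 ^ n : ℕ) : ℝ) *
            (c * ((2 : ℝ) ^ n) ^ (β - 1) * ψ ((2 : ℝ) ^ (n + 1)) ^ γ)) := by
          push_cast; field_simp
      _ ≤ _ := by gcongr
  refine summable_of_sum_range_le (c := (2 ^ β / c) * ∑' k, |f k|) ?_ ?_
  · intro n
    have := (hpos (2 ^ (n + 1)) (by positivity)).le
    positivity
  · intro N
    have hsumIoc : ∀ N : ℕ, ∑ n ∈ Finset.range N, ∑ k ∈ Finset.Ioc (2 ^ n) (2 ^ (n + 1)), f k =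
        ∑ k ∈ Finset.Ioc 1 (2 ^ N), f k := by
      intro N
      induction N with
      | zero => simp
      | succ N ih =>
        rw [Finset.sum_range_succ, ih, Finset.sum_Ioc_consecutive _ Nat.one_le_two_pow
          (Nat.pow_le_pow_right two_pos (Nat.le_succ N))]
    calc _ ≤ ∑ n ∈ Finset.range N, (2 ^ β / c) * ∑ k ∈ Finset.Ioc (2 ^ n) (2 ^ (n + 1)), f k :=
          Finset.sum_le_sum fun n _ => hterm n
      _ = (2 ^ β / c) * ∑ k ∈ Finset.Ioc 1 (2 ^ N), f k := by rw [← Finset.mul_sum, hsumIoc]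
      _ ≤ (2 ^ β / c) * ∑' k, |f k| := by
          refine mul_le_mul_of_nonneg_left ?_ (by positivity)
          exact (Finset.sum_le_sum fun k _ => le_abs_self (f k)).trans
            (hfs.abs.sum_le_tsum _ fun k _ => abs_nonneg (f k))

/-- At a fixed scale, the points of `K` which are `ε`-close to rationals with denominator at most
`Q` are covered by a controlled number of balls of radius comparable to `ε`. -/
lemma exists_finset_cover_of_rationals (d : ℕ) (hd : 0 < d)
    (K : Set (EuclideanSpace ℝ (Fin d))) (μ : Measure (EuclideanSpace ℝ (Fin d)))
    [IsFiniteMeasure μ] (C α r₀ a b δ : ℝ) (hC : 0 < C) (ha : 0 < a) (hb : 0 < b)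
    (hdec : IsAbsolutelyDecaying d K μ C α r₀)
    (hmeas : ∀ x ∈ K, ∀ r : ℝ, 0 < r → r < r₀ →
      ENNReal.ofReal (a * r ^ δ) ≤ μ (ball x r) ∧
        μ (ball x r) ≤ ENNReal.ofReal (b * r ^ δ))
    (r ε Q : ℝ) (hε : 0 < ε) (her : 2 * d * ε ≤ r) (hr : 2 * r < r₀)
    (hQ : ((d + 1).factorial : ℝ) * (2 * r) ^ d * Q ^ (d + 1) < 1) :
    ∃ T : Finset (EuclideanSpace ℝ (Fin d)),
      (∀ x ∈ K, (∃ (p : Fin d → ℤ) (q : ℕ), 0 < q ∧ (q : ℝ) ≤ Q ∧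
        ∀ i, |x i - (p i : ℝ) / q| ≤ ε) → ∃ t ∈ T, x ∈ ball t (2 * (2 * d * ε))) ∧
      (T.card : ℝ) * (a * (r / 2) ^ δ * (a * (2 * d * ε) ^ δ)) ≤
        (μ univ).toReal * (C * (2 * (2 * d * ε) / (2 * r)) ^ α * (b * (2 * r) ^ δ)) := by
  classical
  have hd1 : (1 : ℝ) ≤ d := by exact_mod_cast hd
  set e : ℝ := 2 * d * ε with he
  have he0 : 0 < e := by positivity
  have hde : d * ε < e := by
    have : 0 < d * ε := by positivity
    linarith
  have hεe : ε ≤ e := by nlinarith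
  have hr0 : 0 < r := he0.trans_le her
  obtain ⟨T₁, hT₁K, hT₁, hcard₁⟩ := exists_finset_cover_of_measure_ball μ K univ (r / 2)
    (a * (r / 2) ^ δ) (μ univ).toReal (by positivity) (by positivity) ENNReal.toReal_nonneg
    (fun _ _ => subset_univ _) (fun y hy => (hmeas y hy _ (by positivity) (by linarith)).1)
    (by rw [ENNReal.ofReal_toReal (measure_ne_top _ _)])
  set Z : Set (EuclideanSpace ℝ (Fin d)) := {x | ∃ (p : Fin d → ℤ) (q : ℕ), 0 < q ∧
    (q : ℝ) ≤ Q ∧ ∀ i, |x i - (p i : ℝ) / q| ≤ ε}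
  set M : ℝ := C * (2 * e / (2 * r)) ^ α * (b * (2 * r) ^ δ) with hM
  have hM0 : 0 ≤ M := by positivity
  have hlocal : ∀ t : EuclideanSpace ℝ (Fin d), ∃ T : Finset (EuclideanSpace ℝ (Fin d)),
      t ∈ T₁ → (K ∩ Z ∩ ball t r ⊆ ⋃ y ∈ T, ball y (2 * e)) ∧ (T.card : ℝ) * (a * e ^ δ) ≤ M := by
    intro t
    by_cases ht : t ∈ T₁
    swap
    · exact ⟨∅, fun h => absurd h ht⟩
    have htK : t ∈ K := hT₁K ht
    obtain ⟨L, hLne, hLdim, hL⟩ := exists_hyperplane_of_rationals d hd t (2 * r) Q (by positivity) hQ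
    have hthick : K ∩ Z ∩ ball t r ⊆ thickening e (L : Set (EuclideanSpace ℝ (Fin d))) := by
      rintro x ⟨⟨_, p, q, hq, hqQ, hx⟩, hxt⟩
      refine mem_thickening_iff.2 ⟨_, hL p q hq hqQ fun j => ?_, ?_⟩
      · have h1 : |x j - t j| ≤ r := by
          have := PiLp.norm_apply_le (x - t) j
          rw [← dist_eq_norm x t, Real.norm_eq_abs] at this
          exact this.trans (mem_ball.1 hxt).le
        have h2 := hx j
        rw [abs_le] at h1 h2 ⊢
        constructor <;> linarith [h1.1, h1.2, h2.1, h2.2]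
      · refine lt_of_le_of_lt ?_ hde
        rw [EuclideanSpace.dist_eq]
        refine Real.sqrt_le_iff.2 ⟨by positivity, ?_⟩
        calc ∑ i, dist (x i) ((p i : ℝ) / q) ^ 2 ≤ ∑ _i : Fin d, ε ^ 2 :=
              Finset.sum_le_sum fun i _ => pow_le_pow_left₀ dist_nonneg (hx i) 2
          _ = d * ε ^ 2 := by simp
          _ ≤ (d * ε) ^ 2 := by
              rw [mul_pow]
              exact mul_le_mul_of_nonneg_right (by nlinarith) (sq_nonneg ε)
    have hsub : ∀ y ∈ K ∩ Z ∩ ball t r, ball y e ⊆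
        ball t (2 * r) ∩ thickening (2 * e) (L : Set (EuclideanSpace ℝ (Fin d))) := by
      intro y hy
      refine subset_inter (ball_subset_ball' ?_) ?_
      · have := mem_ball.1 hy.2
        linarith
      · obtain ⟨z, hz, hyz⟩ := mem_thickening_iff.1 (hthick hy)
        intro w hw
        refine mem_thickening_iff.2 ⟨z, hz, ?_⟩
        have := dist_triangle w y z
        have := mem_ball.1 hw
        linarith
    have hmass : μ (ball t (2 * r) ∩ thickening (2 * e) (L : Set (EuclideanSpace ℝ (Fin d)))) ≤
        ENNReal.ofReal M := by
      refine (hdec L hLne hLdim (2 * e) (by positivity) t htK (2 * r) (by positivity) hr).trans ?_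
      rw [hM, ENNReal.ofReal_mul (p := C * (2 * e / (2 * r)) ^ α) (by positivity)]
      gcongr
      exact (hmeas t htK _ (by positivity) hr).2
    obtain ⟨T, _, hT, hTcard⟩ := exists_finset_cover_of_measure_ball μ (K ∩ Z ∩ ball t r) _ e
      (a * e ^ δ) M he0 (by positivity) hM0 hsub
      (fun y hy => (hmeas y hy.1.1 e he0 (by linarith)).1) hmass
    exact ⟨T, fun _ => ⟨hT, hTcard⟩⟩
  choose T₂ hT₂ using hlocal
  refine ⟨T₁.biUnion T₂, ?_, ?_⟩
  · intro x hxK hx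
    obtain ⟨t, ht, hxt⟩ := mem_iUnion₂.1 (hT₁ hxK)
    rw [mul_div_cancel₀ r two_ne_zero] at hxt
    obtain ⟨y, hy, hxy⟩ := mem_iUnion₂.1 ((hT₂ t ht).1 ⟨⟨hxK, hx⟩, hxt⟩)
    exact ⟨y, Finset.mem_biUnion.2 ⟨t, ht, hy⟩, hxy⟩
  · have h1 : ((T₁.biUnion T₂).card : ℝ) * (a * e ^ δ) ≤ T₁.card * M := by
      calc ((T₁.biUnion T₂).card : ℝ) * (a * e ^ δ)
          ≤ (∑ t ∈ T₁, ((T₂ t).card : ℝ)) * (a * e ^ δ) := by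
            gcongr
            exact_mod_cast Finset.card_biUnion_le
        _ = ∑ t ∈ T₁, ((T₂ t).card : ℝ) * (a * e ^ δ) := Finset.sum_mul _ _ _
        _ ≤ ∑ _t ∈ T₁, M := Finset.sum_le_sum fun t ht => (hT₂ t ht).2
        _ = T₁.card * M := by simp
    calc ((T₁.biUnion T₂).card : ℝ) * (a * (r / 2) ^ δ * (a * e ^ δ))
        = (a * (r / 2) ^ δ) * (((T₁.biUnion T₂).card : ℝ) * (a * e ^ δ)) := by ring
      _ ≤ (a * (r / 2) ^ δ) * (T₁.card * M) := by gcongr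
      _ = (T₁.card * (a * (r / 2) ^ δ)) * M := by ring
      _ ≤ _ := by gcongr

/-- A well approximable point has approximations with denominators in arbitrarily high dyadic
blocks. -/
lemma exists_dyadic_of_mem_wellApprox (d : ℕ) (ψ : ℝ → ℝ)
    (hmono : ∀ x y : ℝ, 0 < x → x ≤ y → ψ y ≤ ψ x)
    (x : EuclideanSpace ℝ (Fin d)) (hx : x ∈ WellApprox d ψ) (N : ℕ) :
    ∃ n, N ≤ n ∧ ∃ (p : Fin d → ℤ) (q : ℕ), 0 < q ∧ (q : ℝ) ≤ 2 ^ (n + 1) ∧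
      ∀ i, |x i - (p i : ℝ) / q| ≤ ψ (2 ^ n) := by
  have hfin : {pq : (Fin d → ℤ) × ℕ | pq.2 < 2 ^ N ∧ 0 < pq.2 ∧
      ∀ i, |x i - (pq.1 i : ℝ) / (pq.2 : ℝ)| ≤ ψ (pq.2 : ℝ)}.Finite := by
    have hF : (⋃ q ∈ Finset.range (2 ^ N), (fun p : Fin d → ℤ => (p, q)) ''
        (univ.pi fun i => Icc ⌊q * (x i - ψ q)⌋ ⌈q * (x i + ψ q)⌉)).Finite := by
      refine Set.Finite.biUnion (Finset.finite_toSet _) fun q _ => Set.Finite.image _ ?_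
      exact Set.Finite.pi fun i => Set.finite_Icc _ _
    refine hF.subset ?_
    rintro ⟨p, q⟩ ⟨h1, h2, h3⟩
    refine mem_iUnion₂.2 ⟨q, Finset.mem_range.2 h1, p, ?_, rfl⟩
    intro i _
    have hq : (0 : ℝ) < q := by exact_mod_cast h2
    have h := abs_le.1 (h3 i)
    dsimp only at h
    have hp : (p i : ℝ) = q * ((p i : ℝ) / q) := by field_simp
    constructor
    · have : (⌊q * (x i - ψ q)⌋ : ℝ) ≤ p i := (Int.floor_le _).trans (by
        rw [hp]
        exact mul_le_mul_of_nonneg_left (by linarith [h.2]) hq.le)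
      exact_mod_cast this
    · have : (p i : ℝ) ≤ ⌈q * (x i + ψ q)⌉ := le_trans (by
        rw [hp]
        exact mul_le_mul_of_nonneg_left (by linarith [h.1]) hq.le) (Int.le_ceil _)
      exact_mod_cast this
  have hx' : {pq : (Fin d → ℤ) × ℕ | 0 < pq.2 ∧
      ∀ i, |x i - (pq.1 i : ℝ) / (pq.2 : ℝ)| ≤ ψ (pq.2 : ℝ)}.Infinite := hx
  obtain ⟨⟨p, q⟩, ⟨hq, hpq⟩, hnot⟩ := (hx'.sdiff hfin).nonempty
  have hqN : 2 ^ N ≤ q := by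
    by_contra hlt
    exact hnot ⟨not_le.1 hlt, hq, hpq⟩
  refine ⟨Nat.log 2 q, Nat.le_log_of_pow_le one_lt_two hqN, p, q, hq, ?_, fun i => ?_⟩
  · exact_mod_cast (Nat.lt_pow_succ_log_self one_lt_two q).le
  · refine (hpq i).trans (hmono _ _ (by positivity) ?_)
    exact_mod_cast Nat.pow_log_le_self 2 hq.ne'

/-- Hausdorff measure theorem: under the Ahlfors-type condition
a r^δ ≤ μ(B(x,r)) ≤ b r^δ, if s ≤ δ and ∑ r^{α(d+1)/d-1} ψ(r)^{α+s-δ} < ∞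
then H^s(K ∩ W(ψ)) = 0. -/
theorem stmt_5 (d : ℕ) (hd : 0 < d) (K : Set (EuclideanSpace ℝ (Fin d)))
    (hK : IsCompact K) (μ : Measure (EuclideanSpace ℝ (Fin d))) [IsFiniteMeasure μ]
    (hsupp : μ Kᶜ = 0)
    (C D α r₀ a b δ : ℝ) (hC : 0 < C) (hD : 0 < D) (hα : 0 < α) (hr₀ : 0 < r₀)
    (ha : 0 < a) (hb : 0 < b) (hδ : 0 < δ)
    (hdbl : IsDoubling d K μ D r₀) (hdec : IsAbsolutelyDecaying d K μ C α r₀)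
    (hmeas : ∀ x ∈ K, ∀ r : ℝ, 0 < r → r < r₀ →
      ENNReal.ofReal (a * r ^ δ) ≤ μ (ball x r) ∧
        μ (ball x r) ≤ ENNReal.ofReal (b * r ^ δ))
    (ψ : ℝ → ℝ) (hpos : ∀ r : ℝ, 0 < r → 0 < ψ r)
    (hmono : ∀ x y : ℝ, 0 < x → x ≤ y → ψ y ≤ ψ x)
    (s : ℝ) (hs : 0 ≤ s) (hsδ : s ≤ δ)
    (hsum : Summable fun n : ℕ =>
      ((n : ℝ) + 1) ^ (α * ((d : ℝ) + 1) / d - 1) * ψ ((n : ℝ) + 1) ^ (α + s - δ)) :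
    μH[s] (K ∩ WellApprox d ψ) = 0 := by
  have hd1 : (1 : ℝ) ≤ d := by exact_mod_cast hd
  have hd0 : (0 : ℝ) < d := by positivity
  set β : ℝ := α * ((d : ℝ) + 1) / d with hβ
  have hβ0 : 0 < β := by positivity
  set γ : ℝ := α + s - δ with hγ
  have hγ0 : 0 < γ := by
    by_contra hneg
    rw [not_lt] at hneg
    have h1 : 0 < ψ 1 ^ γ := Real.rpow_pos_of_pos (hpos 1 one_pos) _
    have h2 : Summable fun n : ℕ => ((n : ℝ) + 1) ^ (β - 1) := by
      refine Summable.of_nonneg_of_le (fun n => by positivity) (fun n => ?_)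
        (hsum.mul_left (ψ 1 ^ γ)⁻¹)
      have h3 : ψ 1 ^ γ ≤ ψ ((n : ℝ) + 1) ^ γ :=
        Real.rpow_le_rpow_of_nonpos (hpos _ (by positivity))
          (hmono _ _ one_pos (by linarith [n.cast_nonneg (α := ℝ)])) hneg
      rw [← div_eq_inv_mul, le_div_iff₀ h1]
      gcongr
    have h4 : Summable fun n : ℕ => (n : ℝ) ^ (β - 1) := by
      rw [← summable_nat_add_iff 1]
      simpa using h2
    linarith [Real.summable_nat_rpow.1 h4]
  have hu := summable_dyadic_of_summable β γ hγ0.le ψ hpos hmono hsum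
  set M : ℝ := 2 ^ (2 * d + 1) * ((d + 1).factorial : ℝ) with hM
  have hM1 : 1 ≤ M := by
    have h1 : (1 : ℝ) ≤ 2 ^ (2 * d + 1) := one_le_pow₀ one_le_two
    have h2 : (1 : ℝ) ≤ ((d + 1).factorial : ℝ) := by exact_mod_cast (d + 1).factorial_pos
    nlinarith
  set κ : ℝ := 1 / (2 * M) with hκ
  have hκ0 : 0 < κ := by positivity
  have hκ1 : κ ≤ 1 := by
    rw [hκ, div_le_one (by positivity)]
    linarith
  set τ : ℝ := ((d : ℝ) + 1) / d with hτ
  have hτ0 : 0 < τ := by positivity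
  set r : ℕ → ℝ := fun n => κ * ((2 : ℝ) ^ n) ^ (-τ) with hr
  have hrpos : ∀ n, 0 < r n := fun n => by positivity
  have hr1 : ∀ n, r n ≤ 1 := fun n =>
    mul_le_one₀ hκ1 (by positivity)
      (Real.rpow_le_one_of_one_le_of_nonpos (one_le_pow₀ one_le_two) (by linarith))
  have hrd : ∀ n, ((d + 1).factorial : ℝ) * (2 * r n) ^ d * (2 ^ (n + 1)) ^ (d + 1) < 1 := by
    intro n
    have h1 : (((2 : ℝ) ^ n) ^ (-τ)) ^ d = (((2 : ℝ) ^ n) ^ (d + 1))⁻¹ := by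
      rw [← Real.rpow_natCast, ← Real.rpow_mul (by positivity),
        show -τ * (d : ℝ) = -((d + 1 : ℕ) : ℝ) by rw [hτ]; push_cast; field_simp,
        Real.rpow_neg (by positivity), Real.rpow_natCast]
    have h2 : ((d + 1).factorial : ℝ) * (2 * r n) ^ d * (2 ^ (n + 1)) ^ (d + 1) = M * κ ^ d := by
      rw [hr, hM, mul_pow, mul_pow, h1, pow_succ (2 : ℝ) n, mul_pow]
      field_simp
      ring
    rw [h2]
    calc M * κ ^ d ≤ M * κ := by
          gcongr
          exact pow_le_of_le_one hκ0.le hκ1 hd.ne'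
      _ = 1 / 2 := by rw [hκ]; field_simp
      _ < 1 := by norm_num
  have hrα : ∀ n, (r n) ^ (-α) = κ ^ (-α) * ((2 : ℝ) ^ n) ^ β := fun n => by
    rw [hr, Real.mul_rpow hκ0.le (by positivity), ← Real.rpow_mul (by positivity)]
    congr 2
    rw [hβ, hτ]
    ring
  set e : ℕ → ℝ := fun n => 2 * d * ψ (2 ^ n) with he
  have hepos : ∀ n, 0 < e n := fun n => by
    have := hpos (2 ^ n) (by positivity)
    positivity
  have heγ : ∀ n, (e n) ^ γ * (r n) ^ (-α) =
      ((2 * d) ^ γ * κ ^ (-α)) * (((2 : ℝ) ^ n) ^ β * ψ (2 ^ n) ^ γ) := fun n => by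
    rw [hrα, he, Real.mul_rpow (by positivity) (hpos _ (by positivity)).le]
    ring
  have hsmall : ∀ᶠ n in Filter.atTop, e n ≤ r n := by
    have h0 : Filter.Tendsto (fun n => (e n) ^ γ * (r n) ^ (-α)) Filter.atTop (nhds 0) := by
      simp_rw [heγ]
      simpa using hu.tendsto_atTop_zero.const_mul ((2 * d) ^ γ * κ ^ (-α))
    filter_upwards [h0.eventually_le_const one_pos] with n hn
    rw [Real.rpow_neg (hrpos n).le, ← div_eq_mul_inv,
      div_le_one (Real.rpow_pos_of_pos (hrpos n) _)] at hn
    exact (Real.rpow_le_rpow_iff (hepos n).le (hrpos n).le hγ0).1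
      (hn.trans (Real.rpow_le_rpow_of_exponent_ge (hrpos n) (hr1 n) (by linarith)))
  have hrlim : Filter.Tendsto r Filter.atTop (nhds 0) := by
    have h1 : Filter.Tendsto (fun n : ℕ => ((2 : ℝ) ^ n) ^ (-τ)) Filter.atTop (nhds 0) :=
      (tendsto_rpow_neg_atTop hτ0).comp (tendsto_pow_atTop_atTop_of_one_lt one_lt_two)
    simpa using h1.const_mul κ
  have helim : Filter.Tendsto e Filter.atTop (nhds 0) :=
    squeeze_zero' (Filter.Eventually.of_forall fun n => (hepos n).le) hsmall hrlim
  have hr0 : ∀ᶠ n in Filter.atTop, r n < r₀ / 2 := hrlim.eventually_lt_const (by positivity)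
  obtain ⟨N₀, hN₀⟩ := Filter.eventually_atTop.1 (hsmall.and hr0)
  set c : ℝ := 2 ^ s * ((μ univ).toReal * C * b * 4 ^ δ / a ^ 2 * ((2 * d) ^ γ * κ ^ (-α))) with hc
  have hlevel : ∀ n, ∃ T : Finset (EuclideanSpace ℝ (Fin d)),
      (N₀ ≤ n → ∀ x ∈ K, (∃ (p : Fin d → ℤ) (q : ℕ), 0 < q ∧ (q : ℝ) ≤ 2 ^ (n + 1) ∧
        ∀ i, |x i - (p i : ℝ) / q| ≤ ψ (2 ^ n)) → ∃ t ∈ T, x ∈ ball t (2 * e n)) ∧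
      (T.card : ℝ) * (2 * e n) ^ s ≤ c * (((2 : ℝ) ^ n) ^ β * ψ (2 ^ n) ^ γ) := by
    intro n
    by_cases hn : N₀ ≤ n
    swap
    · refine ⟨∅, fun h => absurd h hn, ?_⟩
      have := hpos (2 ^ n) (by positivity)
      simp only [Finset.card_empty, Nat.cast_zero, zero_mul]
      positivity
    obtain ⟨h1, h2⟩ := hN₀ n hn
    obtain ⟨T, hT, hcard⟩ := exists_finset_cover_of_rationals d hd K μ C α r₀ a b δ hC ha hb hdec
      hmeas (r n) (ψ (2 ^ n)) (2 ^ (n + 1)) (hpos _ (by positivity)) h1 (by linarith) (hrd n)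
    refine ⟨T, fun _ => hT, ?_⟩
    change (T.card : ℝ) * (a * (r n / 2) ^ δ * (a * (e n) ^ δ)) ≤
      (μ univ).toReal * (C * (2 * e n / (2 * r n)) ^ α * (b * (2 * r n) ^ δ)) at hcard
    have hR := hrpos n
    have hE := hepos n
    have hRδ : 0 < r n ^ δ := Real.rpow_pos_of_pos hR _
    have hRα : 0 < r n ^ α := Real.rpow_pos_of_pos hR _
    have hEδ : 0 < e n ^ δ := Real.rpow_pos_of_pos hE _
    have h4 : (4 : ℝ) ^ δ = 2 ^ δ * 2 ^ δ := by
      rw [← Real.mul_rpow zero_le_two zero_le_two]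
      norm_num
    rw [mul_div_mul_left _ _ two_ne_zero, Real.div_rpow hE.le hR.le, Real.div_rpow hR.le zero_le_two,
      Real.mul_rpow zero_le_two hR.le, ← le_div_iff₀ (by positivity)] at hcard
    calc (T.card : ℝ) * (2 * e n) ^ s
        ≤ (μ univ).toReal * (C * (e n ^ α / r n ^ α) * (b * (2 ^ δ * r n ^ δ))) /
            (a * (r n ^ δ / 2 ^ δ) * (a * e n ^ δ)) * (2 * e n) ^ s := by gcongr
      _ = 2 ^ s * ((μ univ).toReal * C * b * 4 ^ δ / a ^ 2 * ((e n) ^ γ * (r n) ^ (-α))) := by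
          rw [hγ, Real.rpow_sub hE, Real.rpow_add hE, Real.rpow_neg hR.le,
            Real.mul_rpow zero_le_two hE.le, h4]
          field_simp
      _ = c * (((2 : ℝ) ^ n) ^ β * ψ (2 ^ n) ^ γ) := by
          rw [heγ, hc]
          ring
  choose T hT hTcard using hlevel
  refine hausdorffMeasure_eq_zero_of_summable _ s hs T (fun n => 2 * e n)
    (fun n => by linarith [hepos n]) ?_ (by simpa using helim.const_mul 2) ?_ ?_
  · intro m n hmn
    have := hmono (2 ^ m) (2 ^ n) (by positivity) (pow_le_pow_right₀ one_le_two hmn)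
    simp only [he]
    gcongr
  · rintro x ⟨hxK, hxW⟩ N
    obtain ⟨n, hn, hx⟩ := exists_dyadic_of_mem_wellApprox d ψ hmono x hxW (max N N₀)
    exact ⟨n, (le_max_left _ _).trans hn, hT n ((le_max_right _ _).trans hn) x hxK hx⟩
  · refine Summable.of_nonneg_of_le (fun n => ?_) hTcard (hu.mul_left c)
    have := hepos n
    positivity
end
end

section
/- Let K be a compact subset of ℝ^d equipped with an absolutely α-friendly measure μ satisfying a·r^δ ≤ μ(B(x,r)) ≤ b·r^δ for all x ∈ K and r < r₀. Let ψ : ℝ⁺ → ℝ⁺ be decreasing with lower order λ_ψ := liminf_{r→∞} (−log ψ(r))/(log r) ≥ (d+1)/d. Then the Hausdorff dimension of K ∩ W(ψ) is at most δ − α(1 − (d+1)/(λ_ψ·d)). -/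
open MeasureTheory Metric Set

noncomputable section

open Filter Topology Module
open scoped NNReal ENNReal Nat

/-- The matrix whose columns are the points `v i` in homogeneous coordinates. -/
def homogeneousMatrix {R : Type*} [One R] {d : ℕ} (v : Fin (d + 1) → Fin d → R) :
    Matrix (Fin (d + 1)) (Fin (d + 1)) R :=
  Matrix.of fun j i => (Fin.cons 1 (v i) : Fin (d + 1) → R) j

theorem det_homogeneousMatrix_sub {R : Type*} [CommRing R] {d : ℕ}
    (v : Fin (d + 1) → Fin d → R) (x : Fin d → R) :
    (homogeneousMatrix fun i => v i - x).det = (homogeneousMatrix v).det := by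
  refine Matrix.det_eq_of_forall_row_eq_smul_add_const (Fin.cons 0 (-x)) 0 rfl fun j i => ?_
  refine Fin.cases ?_ (fun j => ?_) j
  · simp [homogeneousMatrix]
  · simp [homogeneousMatrix, sub_eq_add_neg]

theorem abs_det_homogeneousMatrix_le {d : ℕ} {v : Fin (d + 1) → Fin d → ℝ} {x : Fin d → ℝ}
    {R : ℝ} (h : ∀ i j, |v i j - x j| ≤ R) :
    |(homogeneousMatrix v).det| ≤ (d + 1)! * R ^ d := by
  rw [← det_homogeneousMatrix_sub v x, ← Matrix.det_transpose, Matrix.det_apply]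
  refine (Finset.abs_sum_le_sum_abs _ _).trans ?_
  calc _ ≤ ∑ _σ : Equiv.Perm (Fin (d + 1)), R ^ d := by
        refine Finset.sum_le_sum fun σ _ => ?_
        rcases Int.units_eq_one_or (Equiv.Perm.sign σ) with hσ | hσ <;>
        · simp only [hσ, Units.neg_smul, one_smul, abs_neg, Matrix.transpose_apply,
            Finset.abs_prod, Fin.prod_univ_succ, homogeneousMatrix, Matrix.of_apply,
            Fin.cons_zero, Fin.cons_succ, one_mul, Pi.sub_apply]
          refine (Finset.prod_le_prod (fun _ _ => abs_nonneg _) fun j _ => h _ j).trans ?_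
          simp
    _ = _ := by simp [Fintype.card_perm]

theorem one_le_abs_det_homogeneousMatrix_mul {d : ℕ} {v : Fin (d + 1) → Fin d → ℝ}
    {p : Fin (d + 1) → Fin d → ℤ} {q : Fin (d + 1) → ℕ} (hq : ∀ i, 0 < q i)
    (hv : ∀ i j, v i j = p i j / q i) (hdet : (homogeneousMatrix v).det ≠ 0) :
    1 ≤ |(homogeneousMatrix v).det| * ∏ i, (q i : ℝ) := by
  have hq' : ∀ i, (q i : ℝ) ≠ 0 := fun i => by exact_mod_cast (hq i).ne'
  let N : Matrix (Fin (d + 1)) (Fin (d + 1)) ℤ :=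
    Matrix.of fun j i => (Fin.cons (q i : ℤ) (p i) : Fin (d + 1) → ℤ) j
  have hN : ((N.det : ℤ) : ℝ) = (∏ i, (q i : ℝ)) * (homogeneousMatrix v).det := by
    rw [← Matrix.det_mul_row, Int.cast_det]
    congr 1
    ext j i
    refine Fin.cases ?_ (fun j => ?_) j
    · simp [N, homogeneousMatrix]
    · simp [N, homogeneousMatrix, hv, mul_div_cancel₀ _ (hq' i)]
  have hprod : (0 : ℝ) < ∏ i, (q i : ℝ) :=
    Finset.prod_pos fun i _ => by exact_mod_cast hq i
  have hne : N.det ≠ 0 := fun h0 => by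
    rw [h0, Int.cast_zero, eq_comm, mul_eq_zero] at hN
    exact hN.elim hprod.ne' hdet
  rw [mul_comm, ← abs_of_pos hprod, ← abs_mul, ← hN]
  exact_mod_cast Int.one_le_abs hne

theorem exists_hyperplane_of_forall_det_eq_zero {d : ℕ} (hd : 0 < d)
    (V : Set (EuclideanSpace ℝ (Fin d)))
    (hV : ∀ v : Fin (d + 1) → EuclideanSpace ℝ (Fin d), (∀ i, v i ∈ V) →
      (homogeneousMatrix fun i j => v i j).det = 0) :
    ∃ L : AffineSubspace ℝ (EuclideanSpace ℝ (Fin d)),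
      (L : Set (EuclideanSpace ℝ (Fin d))).Nonempty ∧ finrank ℝ L.direction = d - 1 ∧
        V ⊆ L := by
  have key : ∀ (f : EuclideanSpace ℝ (Fin d) →ₗ[ℝ] ℝ) (v₀ : EuclideanSpace ℝ (Fin d)),
      f ≠ 0 → (∀ v ∈ V, f (v - v₀) = 0) →
      ∃ L : AffineSubspace ℝ (EuclideanSpace ℝ (Fin d)),
      (L : Set (EuclideanSpace ℝ (Fin d))).Nonempty ∧ finrank ℝ L.direction = d - 1 ∧
        V ⊆ L := by
    intro f v₀ hf h
    refine ⟨AffineSubspace.mk' v₀ (LinearMap.ker f),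
      ⟨v₀, AffineSubspace.self_mem_mk' _ _⟩, ?_, fun v hv => ?_⟩
    · have := Dual.finrank_ker_add_one_of_ne_zero (f := f) hf
      rw [finrank_euclideanSpace_fin] at this
      rw [AffineSubspace.direction_mk']
      omega
    · simpa [AffineSubspace.mem_mk'] using h v hv
  rcases V.eq_empty_or_nonempty with rfl | ⟨v₀, hv₀⟩
  · refine key (EuclideanSpace.proj (⟨0, hd⟩ : Fin d)).toLinearMap 0 (fun h => ?_) (by simp)
    simpa using LinearMap.congr_fun h (EuclideanSpace.single ⟨0, hd⟩ 1)
  let u : EuclideanSpace ℝ (Fin d) → Fin (d + 1) → ℝ := fun v => Fin.cons 1 fun j => v j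
  have hlt : Submodule.span ℝ (u '' V) < ⊤ := by
    refine lt_top_iff_ne_top.2 fun htop => ?_
    have hcard : d + 1 = finrank ℝ (Submodule.span ℝ (u '' V)) := by
      rw [htop, finrank_top, finrank_fin_fun]
    obtain ⟨f, hf, hli⟩ : ∃ f : Fin (d + 1) → Fin (d + 1) → ℝ,
        (∀ i, f i ∈ u '' V) ∧ LinearIndependent ℝ f := by
      obtain ⟨f, hf, -, hli⟩ := Submodule.exists_fun_fin_finrank_span_eq ℝ (u '' V)
      exact ⟨f ∘ finCongr hcard, fun i => hf _, hli.comp _ (Equiv.injective _)⟩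
    choose v hv hvf using hf
    have hM : (homogeneousMatrix fun i j => v i j).transpose = Matrix.of f := by
      ext i j
      simp [homogeneousMatrix, ← hvf, u]
    refine ((Matrix.linearIndependent_rows_iff_isUnit (A := Matrix.of f)).1 hli).map
      Matrix.detMonoidHom |>.ne_zero ?_
    simp [← hM, Matrix.det_transpose, hV v hv]
  obtain ⟨g, hg, hker⟩ := Submodule.exists_le_ker_of_lt_top _ hlt
  have hgV : ∀ v ∈ V, g (u v) = 0 := fun v hv =>
    hker (Submodule.subset_span (mem_image_of_mem u hv))
  let ι : EuclideanSpace ℝ (Fin d) →ₗ[ℝ] Fin (d + 1) → ℝ :=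
    { toFun := fun y => Fin.cons 0 fun j => y j
      map_add' := fun y z => by
        ext j; refine Fin.cases ?_ (fun j => ?_) j <;> simp
      map_smul' := fun c y => by
        ext j; refine Fin.cases ?_ (fun j => ?_) j <;> simp }
  refine key (g ∘ₗ ι) v₀ (fun h0 => hg ?_) fun v hv => ?_
  · refine LinearMap.ext fun z => ?_
    have hz : z = z 0 • u v₀ + ι (WithLp.toLp 2 fun j => z j.succ - z 0 * v₀ j) := by
      ext j; refine Fin.cases ?_ (fun j => ?_) j <;> simp [u, ι]
    have := LinearMap.congr_fun h0 (WithLp.toLp 2 fun j => z j.succ - z 0 * v₀ j)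
    rw [hz, map_add, map_smul, hgV v₀ hv₀]
    simpa using this
  · have : ι (v - v₀) = u v - u v₀ := by
      ext j; refine Fin.cases ?_ (fun j => ?_) j <;> simp [u, ι]
    simp [this, hgV v hv, hgV v₀ hv₀]

/-- The simplex lemma: rational points of height at most `Q` lying in a small enough cube are
contained in a common affine hyperplane. -/
theorem exists_hyperplane_of_rational {d : ℕ} (hd : 0 < d) (x : EuclideanSpace ℝ (Fin d))
    {R Q : ℝ} (hRQ : (d + 1)! * R ^ d * Q ^ (d + 1) < 1) (hR : 0 ≤ R) :
    ∃ L : AffineSubspace ℝ (EuclideanSpace ℝ (Fin d)),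
      (L : Set (EuclideanSpace ℝ (Fin d))).Nonempty ∧ finrank ℝ L.direction = d - 1 ∧
        ∀ (v : EuclideanSpace ℝ (Fin d)) (p : Fin d → ℤ) (q : ℕ), 0 < q → (q : ℝ) ≤ Q →
          (∀ j, v j = p j / q) → (∀ j, |v j - x j| ≤ R) → v ∈ L := by
  obtain ⟨L, hL, hLd, hVL⟩ := exists_hyperplane_of_forall_det_eq_zero hd
    {v | ∃ (p : Fin d → ℤ) (q : ℕ), 0 < q ∧ (q : ℝ) ≤ Q ∧
      (∀ j, v j = p j / q) ∧ ∀ j, |v j - x j| ≤ R} fun v hv => by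
    choose p q hq hqQ hvpq hvx using hv
    by_contra hdet
    have h1 := one_le_abs_det_homogeneousMatrix_mul (v := fun i j => v i j) hq hvpq hdet
    have h2 := abs_det_homogeneousMatrix_le (v := fun i j => v i j) hvx
    have h3 : ∏ i, (q i : ℝ) ≤ Q ^ (d + 1) :=
      (Finset.prod_le_prod (fun _ _ => Nat.cast_nonneg _) fun i _ => hqQ i).trans (by simp)
    have h4 := mul_le_mul h2 h3 (Finset.prod_nonneg fun _ _ => Nat.cast_nonneg _)
      (by positivity)
    linarith
  exact ⟨L, hL, hLd, fun v p q hq hqQ hv hvx => hVL ⟨p, q, hq, hqQ, hv, hvx⟩⟩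

section HausdorffDimension

variable {X : Type*} [MetricSpace X] [MeasurableSpace X] [BorelSpace X] {K : Set X}
  {μ : Measure X} {a δ r₀ : ℝ}

theorem exists_finset_cover_of_le_measure_ball (hK : IsCompact K)
    (hμ : ∀ x ∈ K, ∀ r : ℝ, 0 < r → r < r₀ → ENNReal.ofReal (a * r ^ δ) ≤ μ (ball x r))
    {S : Set X} (hS : S ⊆ K) {ρ : ℝ} (hρ : 0 < ρ) (hρr : ρ < r₀) :
    ∃ T : Finset X, (T : Set X) ⊆ S ∧ S ⊆ ⋃ x ∈ T, closedBall x (2 * ρ) ∧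
      T.card * ENNReal.ofReal (a * ρ ^ δ) ≤ μ (thickening ρ S) := by
  have hfin : packingNumber (2 * ρ.toNNReal) S ≠ ⊤ := by
    obtain ⟨N, -, hN, hcov⟩ := exists_finite_isCover_of_totallyBounded
      (ε := ρ.toNNReal) (by simpa using hρ) (hK.totallyBounded.subset hS)
    refine ne_top_of_le_ne_top (encard_ne_top_iff.2 hN) ?_
    exact (packingNumber_two_mul_le_externalCoveringNumber _ _).trans
      hcov.externalCoveringNumber_le_encard
  have hPS : maximalSeparatedSet (2 * ρ.toNNReal) S ⊆ S := maximalSeparatedSet_subset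
  have hsep : IsSeparated _ (maximalSeparatedSet (2 * ρ.toNNReal) S) :=
    isSeparated_maximalSeparatedSet
  have hcov := isCover_iff_subset_iUnion_closedBall.1 (isCover_maximalSeparatedSet hfin)
  have hPfin : (maximalSeparatedSet (2 * ρ.toNNReal) S).Finite := by
    rw [← encard_ne_top_iff, encard_maximalSeparatedSet hfin]
    exact hfin
  refine ⟨hPfin.toFinset, by simpa using hPS, ?_, ?_⟩
  · simpa [hρ.le] using hcov
  · calc _ = ∑ _x ∈ hPfin.toFinset, ENNReal.ofReal (a * ρ ^ δ) := by simp
      _ ≤ ∑ x ∈ hPfin.toFinset, μ (ball x ρ) := Finset.sum_le_sum fun x hx =>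
          hμ x (hS (hPS (by simpa using hx))) ρ hρ hρr
      _ = μ (⋃ x ∈ hPfin.toFinset, ball x ρ) := by
          refine (measure_biUnion_finset (fun x hx y hy hxy => ?_)
            fun _ _ => measurableSet_ball).symm
          refine ball_disjoint_ball ?_
          have : _ < edist x y := hsep (by simpa using hx) (by simpa using hy) hxy
          rw [edist_dist, ENNReal.lt_ofReal_iff_toReal_lt ENNReal.coe_ne_top] at this
          simp [hρ.le] at this
          linarith
      _ ≤ _ := measure_mono <| iUnion₂_subset fun x hx =>
          ball_subset_thickening (hPS (by simpa using hx)) ρ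

theorem dimH_le_of_measure_thickening_le (hK : IsCompact K) (ha : 0 < a)
    (hμ : ∀ x ∈ K, ∀ r : ℝ, 0 < r → r < r₀ → ENNReal.ofReal (a * r ^ δ) ≤ μ (ball x r))
    (hr₀ : 0 < r₀) {s : ℝ≥0} (hs : 0 < s) {E : Set X} {A : ℕ → Set X} {ε c : ℕ → ℝ}
    (hε : ∀ n, 0 < ε n) (hε_anti : Antitone ε) (hε_lim : Tendsto ε atTop (𝓝 0))
    (hA : ∀ n, A n ⊆ K) (hE : ∀ x ∈ E, ∃ᶠ n in atTop, x ∈ A n)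
    (hc : ∀ n, 0 ≤ c n) (hμA : ∀ᶠ n in atTop, μ (thickening (ε n) (A n)) ≤ ENNReal.ofReal (c n))
    (hsum : Summable fun n => c n * ε n ^ ((s : ℝ) - δ)) :
    dimH E ≤ s := by
  obtain ⟨n₀, hn₀⟩ := eventually_atTop.1 (hμA.and (hε_lim.eventually_lt_const hr₀))
  have hT : ∀ n, ∃ T : Finset X, n₀ ≤ n → A n ⊆ ⋃ x ∈ T, closedBall x (2 * ε n) ∧
      T.card * ENNReal.ofReal (a * ε n ^ δ) ≤ ENNReal.ofReal (c n) := by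
    intro n
    by_cases hn : n₀ ≤ n
    · obtain ⟨T, -, h1, h2⟩ :=
        exists_finset_cover_of_le_measure_ball hK hμ (hA n) (hε n) (hn₀ n hn).2
      exact ⟨T, fun _ => ⟨h1, h2.trans (hn₀ n hn).1⟩⟩
    · exact ⟨∅, fun h => absurd h hn⟩
  choose T hT using hT
  have hdiam : ∀ (x : X) n, ediam (closedBall x (2 * ε n)) ≤ ENNReal.ofReal (4 * ε n) := by
    intro x n
    rw [← closedEBall_ofReal (by linarith [hε n])]
    refine ediam_closedEBall_le.trans_eq ?_
    rw [← ENNReal.ofReal_ofNat 2, ← ENNReal.ofReal_mul (by norm_num)]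
    congr 1
    ring
  let t : ℕ → (Σ n, T n) → Set X := fun N i =>
    if N ≤ i.1 then closedBall (i.2 : X) (2 * ε i.1) else ∅
  have hterm : ∀ n, n₀ ≤ n → ∑' _x : T n, ENNReal.ofReal (4 * ε n) ^ (s : ℝ) ≤
      ENNReal.ofReal (4 ^ (s : ℝ) / a * (c n * ε n ^ ((s : ℝ) - δ))) := by
    intro n hn
    have hpos : 0 < a * ε n ^ δ := mul_pos ha (Real.rpow_pos_of_pos (hε n) _)
    have hcard : ((T n).card : ℝ≥0∞) ≤ ENNReal.ofReal (c n / (a * ε n ^ δ)) := by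
      rw [ENNReal.ofReal_div_of_pos hpos]
      exact (ENNReal.le_div_iff_mul_le (by simp [hpos]) (by simp)).2 (hT n hn).2
    rw [tsum_fintype, Finset.sum_const, nsmul_eq_mul, Finset.card_univ, Fintype.card_coe,
      ENNReal.ofReal_rpow_of_pos (by linarith [hε n])]
    refine (mul_le_mul_left hcard _).trans ?_
    rw [← ENNReal.ofReal_mul (div_nonneg (hc n) hpos.le)]
    refine ENNReal.ofReal_le_ofReal (le_of_eq ?_)
    rw [Real.mul_rpow (by norm_num) (hε n).le, Real.rpow_sub (hε n)]
    field_simp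
  have hbound : μH[s] E ≤ ∑' n, ENNReal.ofReal (4 ^ (s : ℝ) / a * (c n * ε n ^ ((s : ℝ) - δ))) := by
    have h := Measure.hausdorffMeasure_le_liminf_tsum (s : ℝ) E (l := atTop)
      (fun N => ENNReal.ofReal (4 * ε N)) ?_ t ?_ ?_
    · refine h.trans ((liminf_le_liminf ?_).trans_eq (liminf_const (f := (atTop : Filter ℕ)) _))
      filter_upwards [eventually_ge_atTop n₀] with N hN
      rw [ENNReal.tsum_sigma']
      refine ENNReal.tsum_le_tsum fun n => ?_
      by_cases hn : N ≤ n
      · refine le_trans (ENNReal.tsum_le_tsum fun x => ?_) (hterm n (hN.trans hn))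
        simp only [t, hn, if_true]
        exact ENNReal.rpow_le_rpow (hdiam _ _) s.2
      · simp [t, hn, hs]
    · simpa using ENNReal.tendsto_ofReal (hε_lim.const_mul 4)
    · refine Eventually.of_forall fun N i => ?_
      by_cases hn : N ≤ i.1
      · simp only [t, hn, if_true]
        exact (hdiam _ _).trans (ENNReal.ofReal_le_ofReal (by linarith [hε_anti hn]))
      · simp [t, hn]
    · filter_upwards [eventually_ge_atTop n₀] with N hN x hx
      obtain ⟨n, hn, hxn⟩ := frequently_atTop.1 (hE x hx) N
      obtain ⟨y, hy, hxy⟩ := mem_iUnion₂.1 ((hT n (hN.trans hn)).1 hxn)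
      refine mem_iUnion.2 ⟨⟨n, y, hy⟩, ?_⟩
      simpa [t, hn] using hxy
  refine dimH_le_of_hausdorffMeasure_ne_top (ne_top_of_le_ne_top ?_ hbound)
  exact (hsum.mul_left _).tsum_ofReal_ne_top

end HausdorffDimension

theorem EuclideanSpace.dist_le_card_mul {d : ℕ} {x y : EuclideanSpace ℝ (Fin d)} {ε : ℝ}
    (hε : 0 ≤ ε) (h : ∀ i, |x i - y i| ≤ ε) : dist x y ≤ d * ε := by
  rw [EuclideanSpace.dist_eq]
  refine Real.sqrt_le_iff.2 ⟨by positivity, ?_⟩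
  calc ∑ i, dist (x i) (y i) ^ 2 ≤ ∑ _i : Fin d, ε ^ 2 := by
        refine Finset.sum_le_sum fun i _ => ?_
        rw [Real.dist_eq]
        exact pow_le_pow_left₀ (abs_nonneg _) (h i) 2
    _ = d * ε ^ 2 := by simp
    _ ≤ (d * ε) ^ 2 := by
        rw [mul_pow]
        gcongr
        exact_mod_cast Nat.le_self_pow two_ne_zero d

/-- The points of `K` within sup-distance `ε` of a rational point of denominator at most `Q`. -/
def nearRational (d : ℕ) (K : Set (EuclideanSpace ℝ (Fin d))) (Q ε : ℝ) :
    Set (EuclideanSpace ℝ (Fin d)) :=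
  {x ∈ K | ∃ (p : Fin d → ℤ) (q : ℕ), 0 < q ∧ (q : ℝ) ≤ Q ∧ ∀ i, |x i - p i / q| ≤ ε}

theorem measure_thickening_nearRational_le {d : ℕ} (hd : 0 < d)
    {K : Set (EuclideanSpace ℝ (Fin d))} (hK : IsCompact K)
    {μ : Measure (EuclideanSpace ℝ (Fin d))} [IsFiniteMeasure μ]
    {C α r₀ a b δ : ℝ} (hC : 0 < C) (ha : 0 < a)
    (hdec : IsAbsolutelyDecaying d K μ C α r₀)
    (hmeas : ∀ x ∈ K, ∀ r : ℝ, 0 < r → r < r₀ →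
      ENNReal.ofReal (a * r ^ δ) ≤ μ (ball x r) ∧ μ (ball x r) ≤ ENNReal.ofReal (b * r ^ δ))
    {Q ρ ε : ℝ} (hε : 0 < ε) (hερ : ε ≤ ρ) (hρ : 4 * ρ < r₀)
    (hQ : (d + 1)! * (4 * ρ) ^ d * Q ^ (d + 1) < 1) :
    μ (thickening ε (nearRational d K Q ε)) ≤ ENNReal.ofReal (μ.real univ / (a * ρ ^ δ) *
      (C * ((d + 2) * ε / (4 * ρ)) ^ α * (b * (4 * ρ) ^ δ))) := by
  have hρ0 : 0 < ρ := hε.trans_le hερ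
  obtain ⟨T, hTK, hcov, hcard⟩ := exists_finset_cover_of_le_measure_ball hK
    (fun x hx r hr hr' => (hmeas x hx r hr hr').1) Subset.rfl hρ0 (by linarith)
  choose L hL hLd hLmem using fun x : EuclideanSpace ℝ (Fin d) =>
    exists_hyperplane_of_rational hd x hQ (by positivity)
  have hsub : thickening ε (nearRational d K Q ε) ⊆ ⋃ x ∈ T,
      ball x (4 * ρ) ∩ thickening ((d + 2) * ε) (L x : Set (EuclideanSpace ℝ (Fin d))) := by
    intro y hy
    obtain ⟨z, ⟨hzK, p, q, hq, hqQ, hz⟩, hyz⟩ := mem_thickening_iff.1 hy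
    obtain ⟨x, hxT, hzx⟩ := mem_iUnion₂.1 (hcov hzK)
    rw [mem_closedBall] at hzx
    let v : EuclideanSpace ℝ (Fin d) := WithLp.toLp 2 fun i => (p i : ℝ) / q
    have hzv : dist z v ≤ d * ε := EuclideanSpace.dist_le_card_mul hε.le hz
    have hv : v ∈ L x := by
      refine hLmem x v p q hq hqQ (fun _ => rfl) fun i => ?_
      have h1 : |z i - x i| ≤ dist z x := by
        simpa [dist_eq_norm] using PiLp.norm_apply_le (z - x) i
      have h2 := hz i
      have h3 : v i = (p i : ℝ) / q := rfl
      rw [← h3] at h2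
      rw [abs_le] at h1 h2 ⊢
      constructor <;> linarith
    refine mem_iUnion₂.2 ⟨x, hxT, ?_, mem_thickening_iff.2 ⟨v, hv, ?_⟩⟩
    · rw [mem_ball]
      linarith [dist_triangle y z x]
    · linarith [dist_triangle y z v]
  have hpos : 0 < a * ρ ^ δ := by positivity
  have hcard' : (T.card : ℝ≥0∞) ≤ ENNReal.ofReal (μ.real univ / (a * ρ ^ δ)) := by
    rw [ENNReal.ofReal_div_of_pos hpos, ofReal_measureReal]
    exact (ENNReal.le_div_iff_mul_le (by simp [hpos]) (by simp)).2
      (hcard.trans (measure_mono (subset_univ _)))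
  calc μ (thickening ε (nearRational d K Q ε))
      ≤ ∑ x ∈ T, μ (ball x (4 * ρ) ∩
          thickening ((d + 2) * ε) (L x : Set (EuclideanSpace ℝ (Fin d)))) :=
        (measure_mono hsub).trans (measure_biUnion_finset_le _ _)
    _ ≤ ∑ _x ∈ T, ENNReal.ofReal (C * ((d + 2) * ε / (4 * ρ)) ^ α * (b * (4 * ρ) ^ δ)) := by
        refine Finset.sum_le_sum fun x hx => ?_
        refine (hdec (L x) (hL x) (hLd x) _ (by positivity) x (hTK hx) (4 * ρ) (by positivity)
          hρ).trans ?_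
        exact (mul_le_mul' le_rfl (hmeas x (hTK hx) (4 * ρ) (by positivity) hρ).2).trans_eq
          (ENNReal.ofReal_mul (by positivity)).symm
    _ ≤ _ := by
        rw [Finset.sum_const, nsmul_eq_mul]
        exact (mul_le_mul' hcard' le_rfl).trans_eq (ENNReal.ofReal_mul (by positivity)).symm

theorem dimH_le_of_isCompact {X : Type*} [MetricSpace X] [MeasurableSpace X] [BorelSpace X]
    {K : Set X} {μ : Measure X} [IsFiniteMeasure μ] {a δ r₀ : ℝ} (hK : IsCompact K) (ha : 0 < a)
    (hμ : ∀ x ∈ K, ∀ r : ℝ, 0 < r → r < r₀ → ENNReal.ofReal (a * r ^ δ) ≤ μ (ball x r))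
    (hr₀ : 0 < r₀) {s : ℝ≥0} (hs : 0 < s) (hδs : δ < s) : dimH K ≤ s := by
  refine dimH_le_of_measure_thickening_le hK ha hμ hr₀ hs (A := fun _ => K)
    (ε := fun n => (1 / 2) ^ n) (c := fun _ => μ.real univ) (fun n => by positivity)
    (pow_right_anti₀ (by norm_num) (by norm_num))
    (tendsto_pow_atTop_nhds_zero_of_lt_one (by norm_num) (by norm_num)) (fun _ => Subset.rfl)
    (fun x hx => Frequently.of_forall fun _ => hx) (fun _ => measureReal_nonneg)
    (Eventually.of_forall fun n => ?_) (Summable.mul_left _ ?_)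
  · rw [ofReal_measureReal]
    exact measure_mono (subset_univ _)
  · simp_rw [← Real.rpow_natCast, ← Real.rpow_mul (by norm_num : (0 : ℝ) ≤ 1 / 2),
      mul_comm _ ((s : ℝ) - δ), Real.rpow_mul (by norm_num : (0 : ℝ) ≤ 1 / 2), Real.rpow_natCast]
    exact summable_geometric_of_lt_one (by positivity)
      (Real.rpow_lt_one (by norm_num) (by norm_num) (by linarith))

theorem finite_setOf_approx {d : ℕ} (x : Fin d → ℝ) (ε : ℝ) {q : ℕ} (hq : 0 < q) :
    {p : Fin d → ℤ | ∀ i, |x i - p i / q| ≤ ε}.Finite := by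
  refine (Set.finite_Icc (fun i => ⌈q * (x i - ε)⌉) fun i => ⌊q * (x i + ε)⌋).subset
    fun p hp => ⟨fun i => Int.ceil_le.2 ?_, fun i => Int.le_floor.2 ?_⟩
  all_goals
    have hq' : (0 : ℝ) < q := by exact_mod_cast hq
    have := abs_le.1 (hp i)
    have h2 : (p i : ℝ) = q * (p i / q) := by field_simp
    rw [h2]
    refine mul_le_mul_of_nonneg_left ?_ hq'.le
    linarith

theorem exists_denominator_ge_of_mem_WellApprox {d : ℕ} {ψ : ℝ → ℝ}
    {x : EuclideanSpace ℝ (Fin d)} (hx : x ∈ WellApprox d ψ) (N : ℕ) :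
    ∃ (p : Fin d → ℤ) (q : ℕ), N ≤ q ∧ 0 < q ∧ ∀ i, |x i - p i / q| ≤ ψ q := by
  by_contra! h
  refine hx (Finite.subset ((Set.finite_Icc 1 N).biUnion fun q hq =>
    ((finite_setOf_approx (fun i => x i) (ψ q) hq.1).image fun p => (p, q))) ?_)
  rintro ⟨p, q⟩ ⟨hq, hpq⟩
  have hqN : q ≤ N := by
    by_contra! hN
    obtain ⟨i, hi⟩ := h p q hN.le hq
    exact absurd (hpq i) hi.not_ge
  exact mem_iUnion₂.2 ⟨q, ⟨hq, hqN⟩, p, hpq, rfl⟩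

theorem eventually_le_rpow_of_lt_liminf {ψ : ℝ → ℝ} (hpos : ∀ r : ℝ, 0 < r → 0 < ψ r) {t : ℝ}
    (ht : 0 ≤ t) (h : t < atTop.liminf fun r : ℝ => -Real.log (ψ r) / Real.log r) :
    ∀ᶠ r in atTop, ψ r ≤ r ^ (-t) := by
  rw [liminf_eq] at h
  have hne : {u | ∀ᶠ r : ℝ in atTop, u ≤ -Real.log (ψ r) / Real.log r}.Nonempty := by
    by_contra hne
    rw [not_nonempty_iff_eq_empty.1 hne, Real.sSup_empty] at h
    linarith
  obtain ⟨u, hu, htu⟩ := exists_lt_of_lt_csSup hne h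
  filter_upwards [hu, eventually_gt_atTop 1] with r hr hr1
  have hlog := Real.log_pos hr1
  have hr0 : 0 < r := by linarith
  rw [le_div_iff₀ hlog] at hr
  rw [← Real.log_le_log_iff (hpos r hr0) (by positivity), Real.log_rpow hr0]
  nlinarith

theorem exists_mem_nearRational {d : ℕ} {K : Set (EuclideanSpace ℝ (Fin d))} {ψ : ℝ → ℝ}
    {t : ℝ} (ht : 0 ≤ t) (hψ : ∀ᶠ r in atTop, ψ r ≤ r ^ (-t)) {x : EuclideanSpace ℝ (Fin d)}
    (hx : x ∈ K ∩ WellApprox d ψ) :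
    ∃ᶠ n : ℕ in atTop, x ∈ nearRational d K (2 ^ (n + 1)) (((2 : ℝ) ^ (-t)) ^ n) := by
  obtain ⟨N₀, hN₀⟩ := eventually_atTop.1 hψ
  refine frequently_atTop.2 fun N => ?_
  obtain ⟨p, q, hNq, hq, hpq⟩ :=
    exists_denominator_ge_of_mem_WellApprox hx.2 (max (2 ^ N) ⌈N₀⌉₊)
  have hq' : (0 : ℝ) < q := by exact_mod_cast hq
  have hle : 2 ^ Nat.log 2 q ≤ q := Nat.pow_log_le_self 2 hq.ne'
  have hlt : q < 2 ^ (Nat.log 2 q + 1) := Nat.lt_pow_succ_log_self one_lt_two q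
  refine ⟨Nat.log 2 q, Nat.le_log_of_pow_le one_lt_two ((le_max_left _ _).trans hNq), hx.1,
    p, q, hq, by exact_mod_cast hlt.le, fun i => (hpq i).trans ?_⟩
  refine (hN₀ q ((Nat.le_ceil N₀).trans (by exact_mod_cast (le_max_right _ _).trans hNq))).trans ?_
  rw [← Real.rpow_natCast, ← Real.rpow_mul zero_le_two, mul_comm (-t),
    Real.rpow_mul zero_le_two, Real.rpow_natCast]
  exact Real.rpow_le_rpow_of_nonpos (by positivity) (by exact_mod_cast hle) (by linarith)

theorem dimH_le_of_eventually_le_rpow {d : ℕ} (hd : 0 < d)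
    {K : Set (EuclideanSpace ℝ (Fin d))} (hK : IsCompact K)
    {μ : Measure (EuclideanSpace ℝ (Fin d))} [IsFiniteMeasure μ]
    {C α r₀ a b δ : ℝ} (hC : 0 < C) (hr₀ : 0 < r₀) (ha : 0 < a) (hb : 0 < b)
    (hdec : IsAbsolutelyDecaying d K μ C α r₀)
    (hmeas : ∀ x ∈ K, ∀ r : ℝ, 0 < r → r < r₀ →
      ENNReal.ofReal (a * r ^ δ) ≤ μ (ball x r) ∧ μ (ball x r) ≤ ENNReal.ofReal (b * r ^ δ))
    {ψ : ℝ → ℝ} {t : ℝ} (ht : ((d : ℝ) + 1) / d < t) (hψ : ∀ᶠ r in atTop, ψ r ≤ r ^ (-t))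
    {s : ℝ≥0} (hs : 0 < s) (hts : 0 < α * (t - ((d : ℝ) + 1) / d) + t * (s - δ)) :
    dimH (K ∩ WellApprox d ψ) ≤ s := by
  have hd' : (0 : ℝ) < d := by exact_mod_cast hd
  set κ : ℝ := ((d : ℝ) + 1) / d with hκ
  have hκ0 : 0 < κ := by positivity
  have ht0 : 0 < t := hκ0.trans ht
  set θ : ℝ := 2 ^ (-t) with hθ
  set ω : ℝ := 2 ^ (-κ) with hω
  have hθ0 : 0 < θ := by positivity
  have hω0 : 0 < ω := by positivity
  have hθ1 : θ < 1 := Real.rpow_lt_one_of_one_lt_of_neg one_lt_two (by linarith)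
  have hω1 : ω < 1 := Real.rpow_lt_one_of_one_lt_of_neg one_lt_two (by linarith)
  have hθω : θ / ω < 1 :=
    (div_lt_one hω0).2 (Real.rpow_lt_rpow_of_exponent_lt one_lt_two (by linarith))
  have hωd : ω ^ d * 2 ^ (d + 1) = 1 := by
    rw [hω, ← Real.rpow_natCast, ← Real.rpow_mul zero_le_two, ← Real.rpow_natCast 2 (d + 1),
      ← Real.rpow_add two_pos, hκ]
    convert Real.rpow_zero 2 using 2
    push_cast
    field_simp
    ring
  obtain ⟨k, hk0, hk1⟩ : ∃ k : ℝ, 0 < k ∧ (d + 1)! * (4 * k) ^ d * 2 ^ (d + 1) < 1 := by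
    have hM : (0 : ℝ) < (d + 1)! * 2 ^ (d + 1) := by positivity
    refine ⟨1 / (4 * ((d + 1)! * 2 ^ (d + 1) + 1)), by positivity, ?_⟩
    have h1 : 4 * (1 / (4 * ((d + 1)! * 2 ^ (d + 1) + 1))) =
        1 / (((d + 1)! : ℝ) * 2 ^ (d + 1) + 1) := by field_simp
    have h2 : (1 / (((d + 1)! : ℝ) * 2 ^ (d + 1) + 1)) ^ d ≤
        1 / (((d + 1)! : ℝ) * 2 ^ (d + 1) + 1) :=
      pow_le_of_le_one (by positivity) ((div_le_one (by positivity)).2 (by linarith)) hd.ne'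
    rw [h1, mul_right_comm]
    refine (mul_le_mul_of_nonneg_left h2 hM.le).trans_lt ?_
    rw [mul_one_div, div_lt_one (by positivity)]
    linarith
  refine dimH_le_of_measure_thickening_le hK ha (fun x hx r hr hr' => (hmeas x hx r hr hr').1)
    hr₀ hs (A := fun n => nearRational d K (2 ^ (n + 1)) (θ ^ n)) (ε := fun n => θ ^ n)
    (c := fun n => μ.real univ / (a * (k * ω ^ n) ^ δ) *
      (C * ((d + 2) * θ ^ n / (4 * (k * ω ^ n))) ^ α * (b * (4 * (k * ω ^ n)) ^ δ)))
    (fun n => by positivity) (pow_right_anti₀ hθ0.le hθ1.le)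
    (tendsto_pow_atTop_nhds_zero_of_lt_one hθ0.le hθ1) (fun n => sep_subset _ _)
    (fun x hx => exists_mem_nearRational ht0.le hψ hx) (fun n => by positivity) ?_ ?_
  · have h1 : ∀ᶠ n : ℕ in atTop, (θ / ω) ^ n < k :=
      (tendsto_pow_atTop_nhds_zero_of_lt_one (by positivity) hθω).eventually_lt_const hk0
    have h2 : ∀ᶠ n : ℕ in atTop, ω ^ n < r₀ / (4 * k) :=
      (tendsto_pow_atTop_nhds_zero_of_lt_one hω0.le hω1).eventually_lt_const (by positivity)
    filter_upwards [h1, h2] with n hn1 hn2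
    refine measure_thickening_nearRational_le hd hK hC ha hdec hmeas (by positivity) ?_ ?_ ?_
    · rw [div_pow, div_lt_iff₀ (by positivity)] at hn1
      exact hn1.le
    · rw [lt_div_iff₀ (by positivity)] at hn2
      linarith
    · calc _ = (d + 1)! * (4 * k) ^ d * 2 ^ (d + 1) * (ω ^ d * 2 ^ (d + 1)) ^ n := by ring
        _ < 1 := by rw [hωd, one_pow, mul_one]; exact hk1
  · have hratio : (θ / ω) ^ α * θ ^ ((s : ℝ) - δ) < 1 := by
      rw [hθ, hω, ← Real.rpow_sub two_pos, ← Real.rpow_mul zero_le_two,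
        ← Real.rpow_mul zero_le_two, ← Real.rpow_add two_pos]
      exact Real.rpow_lt_one_of_one_lt_of_neg one_lt_two (by linarith)
    refine ((summable_geometric_of_lt_one (by positivity) hratio).mul_left
      (μ.real univ / a * C * ((d + 2) / (4 * k)) ^ α * b * 4 ^ δ)).congr fun n => ?_
    have h1 : (d + 2) * θ ^ n / (4 * (k * ω ^ n)) = (d + 2) / (4 * k) * (θ / ω) ^ n := by
      rw [div_pow]
      field_simp
    have h2 : ((θ / ω) ^ n) ^ α = ((θ / ω) ^ α) ^ n := Real.rpow_pow_comm (by positivity) _ _ |>.symm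
    have h3 : (θ ^ n) ^ ((s : ℝ) - δ) = (θ ^ ((s : ℝ) - δ)) ^ n :=
      Real.rpow_pow_comm hθ0.le _ _ |>.symm
    have h4 : (0 : ℝ) < (k * ω ^ n) ^ δ := by positivity
    rw [h1, h3, Real.mul_rpow (z := α) (by positivity) (by positivity), h2,
      Real.mul_rpow (z := δ) zero_le_four (by positivity : 0 ≤ k * ω ^ n), mul_pow]
    field_simp

/-- Dimension bound via the lower order λ_ψ of 1/ψ. -/
theorem stmt_6 (d : ℕ) (hd : 0 < d) (K : Set (EuclideanSpace ℝ (Fin d)))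
    (hK : IsCompact K) (μ : Measure (EuclideanSpace ℝ (Fin d))) [IsFiniteMeasure μ]
    (hsupp : μ Kᶜ = 0)
    (C D α r₀ a b δ : ℝ) (hC : 0 < C) (hD : 0 < D) (hα : 0 < α) (hr₀ : 0 < r₀)
    (ha : 0 < a) (hb : 0 < b) (hδ : 0 < δ)
    (hdbl : IsDoubling d K μ D r₀) (hdec : IsAbsolutelyDecaying d K μ C α r₀)
    (hmeas : ∀ x ∈ K, ∀ r : ℝ, 0 < r → r < r₀ →
      ENNReal.ofReal (a * r ^ δ) ≤ μ (ball x r) ∧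
        μ (ball x r) ≤ ENNReal.ofReal (b * r ^ δ))
    (ψ : ℝ → ℝ) (hpos : ∀ r : ℝ, 0 < r → 0 < ψ r)
    (hmono : ∀ x y : ℝ, 0 < x → x ≤ y → ψ y ≤ ψ x)
    (lam : ℝ)
    (hlam : lam = Filter.atTop.liminf (fun r : ℝ => -Real.log (ψ r) / Real.log r))
    (hlam' : ((d : ℝ) + 1) / d ≤ lam) :
    dimH (K ∩ WellApprox d ψ) ≤
      ENNReal.ofReal (δ - α * (1 - ((d : ℝ) + 1) / (lam * d))) := by
  have hd' : (0 : ℝ) < d := by exact_mod_cast hd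
  have hlam0 : 0 < lam := lt_of_lt_of_le (by positivity) hlam'
  have hlow : ∀ x ∈ K, ∀ r : ℝ, 0 < r → r < r₀ → ENNReal.ofReal (a * r ^ δ) ≤ μ (ball x r) :=
    fun x hx r hr hr' => (hmeas x hx r hr hr').1
  refine le_of_forall_gt_imp_ge_of_dense fun s hs => ?_
  obtain rfl | hs_top := eq_or_ne s ⊤
  · exact le_top
  lift s to ℝ≥0 using hs_top
  have hs0 : 0 < s := by exact_mod_cast zero_le.trans_lt hs
  have hsB : δ - α * (1 - ((d : ℝ) + 1) / (lam * d)) < s := by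
    rw [← ENNReal.ofReal_coe_nnreal] at hs
    exact (ENNReal.ofReal_lt_ofReal_iff hs0).1 hs
  rcases hlam'.eq_or_lt with heq | hlt
  · refine (dimH_mono inter_subset_left).trans (dimH_le_of_isCompact hK ha hlow hr₀ hs0 ?_)
    have : ((d : ℝ) + 1) / (lam * d) = 1 := by
      rw [mul_comm, ← div_div, heq, div_self hlam0.ne']
    rw [this] at hsB
    linarith
  · have hts : 0 < α * (lam - ((d : ℝ) + 1) / d) + lam * (s - δ) := by
      have h1 : lam * (((d : ℝ) + 1) / (lam * d)) = ((d : ℝ) + 1) / d := by field_simp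
      nlinarith [mul_lt_mul_of_pos_left hsB hlam0]
    have hcont : Continuous fun t : ℝ => α * (t - ((d : ℝ) + 1) / d) + t * (s - δ) := by
      fun_prop
    obtain ⟨t, ht, ht', htl⟩ := (((hcont.continuousWithinAt (s := Iio lam)).eventually_const_lt
      hts).and (Ioo_mem_nhdsLT hlt)).exists
    refine dimH_le_of_eventually_le_rpow hd hK hC hr₀ ha hb hdec hmeas ht'
      (eventually_le_rpow_of_lt_liminf hpos ?_ (hlam ▸ htl)) hs0 ht
    exact (lt_trans (by positivity) ht').le
end
end

section
/- Let K be a compact subset of ℝ^d equipped with an absolutely α-friendly measure μ satisfying a·r^δ ≤ μ(B(x,r)) ≤ b·r^δ for all x ∈ K and r < r₀. Then for every τ ≥ (d+1)/d, the Hausdorff dimension of K ∩ W(τ) is at most δ − α(1 − (d+1)/(τd)), where W(τ) is the set of x ∈ ℝ^d with max_i |x_i − p_i/q| ≤ q^{−τ} for infinitely many (p,q) ∈ ℤ^d × ℕ. -/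
open MeasureTheory Metric Set

noncomputable section

theorem Matrix.abs_det_le_factorial_mul_prod {n : Type*} [Fintype n] [DecidableEq n]
    (M : Matrix n n ℝ) (w : n → ℝ) (h : ∀ i j, |M i j| ≤ w i) :
    |M.det| ≤ (Fintype.card n).factorial * ∏ i, w i := by
  rw [Matrix.det_apply']
  refine (Finset.abs_sum_le_sum_abs _ _).trans ?_
  have key : ∀ σ : Equiv.Perm n,
      |((Equiv.Perm.sign σ : ℤ) : ℝ) * ∏ i, M (σ i) i| ≤ ∏ i, w i := by
    intro σ
    have hs : |((Equiv.Perm.sign σ : ℤ) : ℝ)| = 1 := by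
      rcases Int.units_eq_one_or (Equiv.Perm.sign σ) with h | h <;> simp [h]
    rw [abs_mul, hs, one_mul, Finset.abs_prod, ← Equiv.prod_comp σ w]
    exact Finset.prod_le_prod (fun i _ => abs_nonneg _) fun i _ => h _ _
  refine (Finset.sum_le_sum fun σ _ => key σ).trans ?_
  simp [Fintype.card_perm]

theorem exists_affineSubspace_level_subset {E : Type*} [NormedAddCommGroup E]
    [InnerProductSpace ℝ E] [FiniteDimensional ℝ E] (φ : E →ₗ[ℝ] ℝ) (hφ : φ ≠ 0) (c : ℝ) :
    ∃ L : AffineSubspace ℝ E, (L : Set E).Nonempty ∧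
      Module.finrank ℝ L.direction = Module.finrank ℝ E - 1 ∧ ∀ x, φ x = c → x ∈ L := by
  obtain ⟨x₀, hx₀⟩ := LinearMap.surjective hφ c
  refine ⟨AffineSubspace.mk' x₀ (LinearMap.ker φ), AffineSubspace.mk'_nonempty _ _, ?_, ?_⟩
  · rw [AffineSubspace.direction_mk', ← Module.Dual.finrank_ker_add_one_of_ne_zero hφ]
    rfl
  · intro x hx
    simp [AffineSubspace.mem_mk', hx, hx₀]

/-- The integer vectors `(q, p)` representing rational points `p / q` of denominator at most `N`
in the cube of radius `ρ` centred at `t`. -/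
def cubeRationals (d : ℕ) (t : Fin d → ℝ) (N ρ : ℝ) : Set (Fin (d + 1) → ℤ) :=
  {v | 0 < v 0 ∧ (v 0 : ℝ) ≤ N ∧ ∀ i : Fin d, |(v i.succ : ℝ) / v 0 - t i| ≤ ρ}

theorem det_eq_zero_of_mem_cubeRationals {d : ℕ} {t : Fin d → ℝ} {N ρ : ℝ}
    (hsmall : (d + 1).factorial * (N ^ (d + 1) * ρ ^ d) < 1)
    (A : Matrix (Fin (d + 1)) (Fin (d + 1)) ℤ) (hA : ∀ j, A.transpose j ∈ cubeRationals d t N ρ) :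
    A.det = 0 := by
  have hN : 0 ≤ N := by
    have h := hA 0
    exact (by exact_mod_cast h.1.le : (0 : ℝ) ≤ A.transpose 0 0).trans h.2.1
  let B : Matrix (Fin (d + 1)) (Fin (d + 1)) ℝ := fun i j =>
    (Fin.cons (A 0 j : ℝ) (fun k : Fin d => (A k.succ j : ℝ) - t k * A 0 j) : Fin (d + 1) → ℝ) i
  have hdet : (A.map (Int.cast : ℤ → ℝ)).det = B.det := by
    refine Matrix.det_eq_of_forall_row_eq_smul_add_const
      (Fin.cons 0 t : Fin (d + 1) → ℝ) 0 (by simp) ?_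
    intro i j
    refine Fin.cases ?_ (fun k => ?_) i
    · simp [B]
    · simp [B]
  have hB : |B.det| ≤ (d + 1).factorial * (N ^ (d + 1) * ρ ^ d) := by
    have := Matrix.abs_det_le_factorial_mul_prod B
      (Fin.cons N (fun _ : Fin d => N * ρ) : Fin (d + 1) → ℝ) ?_
    · simpa [Fin.prod_univ_succ, mul_pow, pow_succ', mul_assoc] using this
    intro i j
    obtain ⟨h0, h1, h2⟩ := hA j
    simp only [Matrix.transpose_apply] at h0 h1 h2
    have h0' : (0 : ℝ) < A 0 j := by exact_mod_cast h0
    refine Fin.cases ?_ (fun k => ?_) i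
    · simpa [B, abs_of_pos h0'] using h1
    · have : B k.succ j = A 0 j * ((A k.succ j : ℝ) / A 0 j - t k) := by
        simp only [B, Fin.cons_succ]
        field_simp
      rw [this, abs_mul, abs_of_pos h0', Fin.cons_succ]
      exact mul_le_mul h1 (h2 k) (abs_nonneg _) hN
  have h1 : |(A.det : ℝ)| < 1 := by
    have : (A.det : ℝ) = (A.map (Int.cast : ℤ → ℝ)).det := by
      simpa using (Int.castRingHom ℝ).map_det A
    rw [this, hdet]
    exact hB.trans_lt hsmall
  exact Int.abs_lt_one_iff.mp (by exact_mod_cast h1)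

/-- The simplex lemma: rational points of small denominator in a small cube lie on a hyperplane. -/
theorem exists_hyperplane_of_cubeRationals {d : ℕ} (hd : 0 < d) (t : Fin d → ℝ) {N ρ : ℝ}
    (hsmall : (d + 1).factorial * (N ^ (d + 1) * ρ ^ d) < 1) :
    ∃ L : AffineSubspace ℝ (EuclideanSpace ℝ (Fin d)),
      (L : Set (EuclideanSpace ℝ (Fin d))).Nonempty ∧ Module.finrank ℝ L.direction = d - 1 ∧
      ∀ v ∈ cubeRationals d t N ρ, WithLp.toLp 2 (fun i : Fin d => (v i.succ : ℝ) / v 0) ∈ L := by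
  let V : Set (Fin (d + 1) → ℝ) := (fun v i => (v i : ℝ)) '' cubeRationals d t N ρ
  have hV : Submodule.span ℝ V < ⊤ := by
    rw [lt_top_iff_ne_top]
    intro htop
    obtain ⟨f, hfV, -, hf⟩ := Submodule.exists_fun_fin_finrank_span_eq ℝ V
    have hrank : Module.finrank ℝ (Submodule.span ℝ V) = d + 1 := by
      rw [htop, finrank_top, Module.finrank_fin_fun]
    choose g hg hgf using hfV
    let e : Fin (d + 1) ≃ Fin (Module.finrank ℝ (Submodule.span ℝ V)) := finCongr hrank.symm
    let A : Matrix (Fin (d + 1)) (Fin (d + 1)) ℤ := Matrix.of fun i j => g (e j) i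
    have hA : A.det = 0 := det_eq_zero_of_mem_cubeRationals hsmall A fun j => hg (e j)
    have hli : LinearIndependent ℝ (A.map (Int.cast : ℤ → ℝ)).transpose.row := by
      have : (A.map (Int.cast : ℤ → ℝ)).transpose.row = f ∘ e := by
        funext j
        exact hgf (e j)
      rw [this]
      exact hf.comp _ e.injective
    rw [Matrix.linearIndependent_rows_iff_isUnit, Matrix.isUnit_iff_isUnit_det,
      Matrix.det_transpose] at hli
    have : (A.map (Int.cast : ℤ → ℝ)).det = (A.det : ℝ) := by
      simpa using ((Int.castRingHom ℝ).map_det A).symm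
    rw [this, hA] at hli
    simp at hli
  obtain ⟨f, hf0, hf⟩ := Submodule.exists_le_ker_of_lt_top _ hV
  let ι : EuclideanSpace ℝ (Fin d) →ₗ[ℝ] (Fin (d + 1) → ℝ) :=
    { toFun := fun x => Fin.cons 0 (fun i => x i)
      map_add' := fun x y => by
        funext i
        refine Fin.cases ?_ (fun k => ?_) i <;> simp
      map_smul' := fun c x => by
        funext i
        refine Fin.cases ?_ (fun k => ?_) i <;> simp }
  let e₀ : Fin (d + 1) → ℝ := Fin.cons 1 0
  have hdecomp : ∀ w : Fin (d + 1) → ℝ,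
      w = w 0 • e₀ + ι (WithLp.toLp 2 fun i => w i.succ) := by
    intro w
    funext i
    refine Fin.cases ?_ (fun k => ?_) i <;> simp [e₀, ι]
  have hzero : ∀ v ∈ cubeRationals d t N ρ,
      (f ∘ₗ ι) (WithLp.toLp 2 (fun i : Fin d => (v i.succ : ℝ) / v 0)) = - f e₀ := by
    intro v hv
    have hv0 : (v 0 : ℝ) ≠ 0 := by exact_mod_cast hv.1.ne'
    have h1 : f (fun i => (v i : ℝ)) = 0 := hf (Submodule.subset_span ⟨v, hv, rfl⟩)
    rw [hdecomp (fun i => (v i : ℝ))] at h1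
    have h2 : (WithLp.toLp 2 (fun i : Fin d => (v i.succ : ℝ)) : EuclideanSpace ℝ (Fin d)) =
        (v 0 : ℝ) • WithLp.toLp 2 (fun i : Fin d => (v i.succ : ℝ) / v 0) := by
      ext i
      simp [mul_div_cancel₀ _ hv0]
    rw [h2, map_smul, map_add, map_smul, map_smul, ← smul_add, smul_eq_mul] at h1
    have := (mul_eq_zero.mp h1).resolve_left hv0
    rw [LinearMap.comp_apply]
    linarith
  by_cases hφ : f ∘ₗ ι = 0
  · have he : f e₀ ≠ 0 := by
      intro h
      apply hf0
      refine LinearMap.ext fun w => ?_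
      have hw := LinearMap.congr_fun hφ (WithLp.toLp 2 fun i => w i.succ)
      rw [LinearMap.comp_apply, LinearMap.zero_apply] at hw
      rw [hdecomp w, map_add, map_smul, h, hw]
      simp
    obtain ⟨L, h1, h2, -⟩ := exists_affineSubspace_level_subset
      ((LinearMap.proj (⟨0, hd⟩ : Fin d)) ∘ₗ
        (WithLp.linearEquiv 2 ℝ (Fin d → ℝ)).toLinearMap)
      (fun h => by
        have := LinearMap.congr_fun h (EuclideanSpace.single ⟨0, hd⟩ (1 : ℝ))
        simp at this) 0
    refine ⟨L, h1, by simpa using h2, fun v hv => absurd (hzero v hv) ?_⟩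
    rw [hφ]
    simpa using he
  · obtain ⟨L, h1, h2, h3⟩ := exists_affineSubspace_level_subset (f ∘ₗ ι) hφ (- f e₀)
    exact ⟨L, h1, by simpa using h2, fun v hv => h3 _ (hzero v hv)⟩

open Filter Topology in
theorem hausdorffMeasure_eq_zero_of_frequently_mem {X : Type*} [MetricSpace X] [MeasurableSpace X]
    [BorelSpace X] {E : Set X} {A : ℕ → Set X} (hE : ∀ x ∈ E, ∃ᶠ n in atTop, x ∈ A n)
    {ε : ℕ → ℝ} (hanti : Antitone ε) (hpos : ∀ n, 0 < ε n) (hε : Tendsto ε atTop (𝓝 0))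
    {s M θ : ℝ} (hs : 0 ≤ s) (hθ₀ : 0 ≤ θ) (hθ : θ < 1)
    (hcov : ∀ᶠ n in atTop, ∃ S : Finset X, (∀ x ∈ A n, ∃ y ∈ S, dist x y ≤ ε n) ∧
      S.card * ε n ^ s ≤ M * θ ^ n) :
    Measure.hausdorffMeasure s E = 0 := by
  obtain ⟨n₀, hn₀⟩ := eventually_atTop.mp hcov
  have hcov' : ∀ n, ∃ S : Finset X, n₀ ≤ n → (∀ x ∈ A n, ∃ y ∈ S, dist x y ≤ ε n) ∧
      S.card * ε n ^ s ≤ M * θ ^ n := by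
    intro n
    by_cases hn : n₀ ≤ n
    · obtain ⟨S, hS⟩ := hn₀ n hn
      exact ⟨S, fun _ => hS⟩
    · exact ⟨∅, fun h => absurd h hn⟩
  choose S hS using hcov'
  have hsum : Summable fun n => ((S n).card : ℝ) * (2 * ε n) ^ s := by
    refine Summable.of_norm_bounded_eventually_nat
      (g := fun n => 2 ^ s * (M * θ ^ n)) ?_ ?_
    · exact ((summable_geometric_of_lt_one hθ₀ hθ).mul_left _).mul_left _
    · filter_upwards [eventually_ge_atTop n₀] with n hn
      have h := (hS n hn).2
      have hp := hpos n
      rw [Real.norm_of_nonneg (by positivity), Real.mul_rpow zero_le_two hp.le]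
      calc ((S n).card : ℝ) * (2 ^ s * ε n ^ s) = 2 ^ s * ((S n).card * ε n ^ s) := by ring
        _ ≤ _ := by gcongr
  have htail := ENNReal.tendsto_sum_nat_add
    (fun n => ENNReal.ofReal (((S n).card : ℝ) * (2 * ε n) ^ s)) hsum.tsum_ofReal_ne_top
  have hdiam : ∀ (n : ℕ) (y : X),
      ediam (closedBall y (ε n)) ≤ ENNReal.ofReal (2 * ε n) := by
    intro n y
    rw [← Metric.closedEBall_ofReal (hpos n).le]
    refine ediam_closedEBall_le.trans_eq ?_
    rw [ENNReal.ofReal_mul zero_le_two, ENNReal.ofReal_ofNat]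
  have hmain := Measure.hausdorffMeasure_le_liminf_tsum (l := atTop) s E
    (ι := fun n : ℕ => Σ k : ℕ, S (k + n)) (fun n => ENNReal.ofReal (2 * ε n))
    (by simpa using ENNReal.tendsto_ofReal (hε.const_mul 2))
    (fun n i => closedBall (i.2 : X) (ε (i.1 + n)))
    (Eventually.of_forall fun n i => (hdiam _ _).trans
      (ENNReal.ofReal_le_ofReal (by linarith [hanti (Nat.le_add_left n i.1)])))
    (by
      filter_upwards [eventually_ge_atTop n₀] with n hn x hx
      obtain ⟨m, hm, hxm⟩ := frequently_atTop.mp (hE x hx) n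
      obtain ⟨k, rfl⟩ := Nat.exists_eq_add_of_le' hm
      obtain ⟨y, hy, hxy⟩ := (hS (k + n) (hn.trans hm)).1 x hxm
      exact mem_iUnion.mpr ⟨⟨k, y, hy⟩, hxy⟩)
  refine le_antisymm (hmain.trans ?_) zero_le
  rw [← htail.liminf_eq]
  refine liminf_le_liminf (Eventually.of_forall fun n => ?_)
  rw [ENNReal.tsum_sigma' (β := fun k => S (k + n))
    fun i => ediam (closedBall (i.2 : X) (ε (i.1 + n))) ^ s]
  refine ENNReal.tsum_le_tsum fun k => ?_
  calc ∑' y : S (k + n), ediam (closedBall (y : X) (ε (k + n))) ^ s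
      ≤ ∑' y : S (k + n), ENNReal.ofReal (2 * ε (k + n)) ^ s :=
        ENNReal.tsum_le_tsum fun y => ENNReal.rpow_le_rpow (hdiam _ _) hs
    _ = _ := by
        have hp := hpos (k + n)
        rw [tsum_fintype, Finset.sum_const, nsmul_eq_mul,
          ENNReal.ofReal_rpow_of_pos (by positivity), ENNReal.ofReal_mul (by positivity)]
        simp

theorem exists_finset_cover_card_mul_le {X : Type*} [MetricSpace X] [MeasurableSpace X]
    [OpensMeasurableSpace X] (μ : Measure X) {A : Set X} (hA : TotallyBounded A) {ε : ℝ}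
    (hε : 0 < ε) {m : ENNReal} (hm : ∀ x ∈ A, m ≤ μ (ball x (ε / 2))) :
    ∃ S : Finset X, ↑S ⊆ A ∧ (∀ x ∈ A, ∃ y ∈ S, dist x y ≤ ε) ∧
      S.card * m ≤ μ (thickening (ε / 2) A) := by
  lift ε to NNReal using hε.le
  have hε' : ε / 2 ≠ 0 := by
    have : 0 < ε := by exact_mod_cast hε
    positivity
  have hpack : packingNumber ε A ≠ ⊤ := by
    obtain ⟨C, -, hCfin, hC⟩ := exists_finite_isCover_of_totallyBounded hε' hA
    have h1 := packingNumber_two_mul_le_externalCoveringNumber (ε / 2) A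
    rw [mul_div_cancel₀ ε two_ne_zero] at h1
    exact ne_top_of_le_ne_top (encard_ne_top_iff.mpr hCfin)
      (h1.trans hC.externalCoveringNumber_le_encard)
  have hfin : (maximalSeparatedSet ε A).Finite := by
    rw [← encard_ne_top_iff, encard_maximalSeparatedSet hpack]
    exact hpack
  have hsub : (hfin.toFinset : Set X) ⊆ A := by
    rw [hfin.coe_toFinset]
    exact maximalSeparatedSet_subset
  refine ⟨hfin.toFinset, hsub, fun x hx => ?_, ?_⟩
  · obtain ⟨y, hy, hxy⟩ := isCover_maximalSeparatedSet hpack hx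
    refine ⟨y, hfin.mem_toFinset.mpr hy, ?_⟩
    change edist x y ≤ ε at hxy
    rw [edist_nndist] at hxy
    exact_mod_cast hxy
  · have hdisj : (hfin.toFinset : Set X).PairwiseDisjoint fun x => ball x ((ε : ℝ) / 2) := by
      intro x hx y hy hxy
      rw [hfin.coe_toFinset] at hx hy
      refine ball_disjoint_ball ?_
      have : (ε : ENNReal) < edist x y := isSeparated_maximalSeparatedSet hx hy hxy
      rw [edist_nndist] at this
      have : (ε : ℝ) < dist x y := by exact_mod_cast this
      linarith
    calc (hfin.toFinset.card : ENNReal) * m = ∑ x ∈ hfin.toFinset, m := by simp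
      _ ≤ ∑ x ∈ hfin.toFinset, μ (ball x (ε / 2)) :=
        Finset.sum_le_sum fun x hx => hm x (hsub hx)
      _ = μ (⋃ x ∈ hfin.toFinset, ball x ((ε : ℝ) / 2)) :=
        (measure_biUnion_finset hdisj fun x _ => measurableSet_ball).symm
      _ ≤ μ (thickening (ε / 2) A) := measure_mono (iUnion₂_subset fun x hx =>
        ball_subset_thickening (hsub hx) _)

theorem finite_setOf_abs_sub_div_le {d : ℕ} (x : Fin d → ℝ) {q : ℕ} (hq : 0 < q) (R : ℝ) :
    {p : Fin d → ℤ | ∀ i, |x i - (p i : ℝ) / q| ≤ R}.Finite := by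
  have hq' : (0 : ℝ) < q := by exact_mod_cast hq
  refine (Set.finite_Icc (fun i => ⌈(x i - R) * q⌉) (fun i => ⌊(x i + R) * q⌋)).subset ?_
  intro p hp
  refine ⟨fun i => Int.ceil_le.mpr ?_, fun i => Int.le_floor.mpr ?_⟩
  · rw [← le_div_iff₀ hq']
    linarith [(abs_le.mp (hp i)).2]
  · rw [← div_le_iff₀ hq']
    linarith [(abs_le.mp (hp i)).1]

/-- The points approximated to within `ψ q` by a rational point whose denominator `q` lies in the
dyadic range `[2 ^ n, 2 ^ (n + 1))`. -/
def dyadicApprox (d : ℕ) (ψ : ℝ → ℝ) (n : ℕ) : Set (EuclideanSpace ℝ (Fin d)) :=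
  {x | ∃ (p : Fin d → ℤ) (q : ℕ), 2 ^ n ≤ q ∧ q < 2 ^ (n + 1) ∧
    ∀ i, |x i - (p i : ℝ) / q| ≤ ψ q}

theorem frequently_mem_dyadicApprox {d : ℕ} {ψ : ℝ → ℝ} {x : EuclideanSpace ℝ (Fin d)}
    (hx : x ∈ WellApprox d ψ) : ∃ᶠ n in Filter.atTop, x ∈ dyadicApprox d ψ n := by
  by_contra h
  obtain ⟨n₀, hn₀⟩ := Filter.eventually_atTop.mp (Filter.not_frequently.mp h)
  refine hx (Set.Finite.subset (Set.Finite.biUnion (Set.finite_Ioo 0 (2 ^ n₀))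
    fun q hq => ((finite_setOf_abs_sub_div_le x hq.1 (ψ q)).prod (Set.finite_singleton q))) ?_)
  rintro ⟨p, q⟩ ⟨hq, hpq⟩
  refine mem_iUnion₂.mpr ⟨q, ⟨hq, ?_⟩, hpq, rfl⟩
  by_contra! hle
  exact hn₀ (Nat.log 2 q) (Nat.le_log_of_pow_le one_lt_two hle)
    ⟨p, q, Nat.pow_log_le_self 2 hq.ne', Nat.lt_pow_succ_log_self one_lt_two q, hpq⟩

theorem dist_le_sqrt_mul_of_forall_abs_sub_le {d : ℕ} {x y : EuclideanSpace ℝ (Fin d)} {R : ℝ}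
    (hR : 0 ≤ R) (h : ∀ i, |x i - y i| ≤ R) : dist x y ≤ √d * R := by
  have hsum : ∑ i, dist (x i) (y i) ^ 2 ≤ d * R ^ 2 := by
    calc ∑ i, dist (x i) (y i) ^ 2 ≤ ∑ _i : Fin d, R ^ 2 :=
          Finset.sum_le_sum fun i _ => pow_le_pow_left₀ dist_nonneg (h i) 2
      _ = d * R ^ 2 := by simp
  rw [EuclideanSpace.dist_eq]
  refine (Real.sqrt_le_sqrt hsum).trans_eq ?_
  rw [Real.sqrt_mul (Nat.cast_nonneg d), Real.sqrt_sq hR]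

theorem abs_sub_le_dist {d : ℕ} (x y : EuclideanSpace ℝ (Fin d)) (i : Fin d) :
    |x i - y i| ≤ dist x y := by
  rw [dist_eq_norm]
  exact PiLp.norm_apply_le (x - y) i

section Covering

variable {d : ℕ} {K : Set (EuclideanSpace ℝ (Fin d))} {μ : Measure (EuclideanSpace ℝ (Fin d))}
  [IsFiniteMeasure μ] {r₀ a δ : ℝ}

theorem exists_cover_card_le_measure_thickening (ha : 0 < a)
    (hmeas : ∀ x ∈ K, ∀ r : ℝ, 0 < r → r < r₀ → ENNReal.ofReal (a * r ^ δ) ≤ μ (ball x r))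
    {A : Set (EuclideanSpace ℝ (Fin d))} (hAK : A ⊆ K) (hA : TotallyBounded A) {ε : ℝ}
    (hε : 0 < ε) (hεr : ε < r₀) :
    ∃ S : Finset (EuclideanSpace ℝ (Fin d)), ↑S ⊆ A ∧ (∀ x ∈ A, ∃ y ∈ S, dist x y ≤ ε) ∧
      (S.card : ℝ) ≤ μ.real (thickening (ε / 2) A) / (a * (ε / 2) ^ δ) := by
  obtain ⟨S, hSA, hS, hcard⟩ := exists_finset_cover_card_mul_le μ hA hε
    fun x hx => hmeas x (hAK hx) (ε / 2) (by linarith) (by linarith)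
  refine ⟨S, hSA, hS, ?_⟩
  have hpos : 0 < a * (ε / 2) ^ δ := by positivity
  rw [le_div_iff₀ hpos, Measure.real, ← ENNReal.ofReal_le_iff_le_toReal (measure_ne_top _ _),
    ENNReal.ofReal_mul (Nat.cast_nonneg _)]
  simpa using hcard

theorem exists_cover_dyadicApprox (hd : 0 < d) (hK : IsCompact K) {C α b : ℝ} (hC : 0 < C)
    (ha : 0 < a) (hb : 0 < b) (hdec : IsAbsolutelyDecaying d K μ C α r₀)
    (hmeas : ∀ x ∈ K, ∀ r : ℝ, 0 < r → r < r₀ →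
      ENNReal.ofReal (a * r ^ δ) ≤ μ (ball x r) ∧ μ (ball x r) ≤ ENNReal.ofReal (b * r ^ δ))
    {ψ : ℝ → ℝ} {n : ℕ} {ε ρ : ℝ} (hε : 0 < ε) (hερ : 4 * ε ≤ ρ) (hρ : ρ < r₀)
    (hψ₀ : ∀ q : ℕ, 0 ≤ ψ q) (hψ : ∀ q : ℕ, 2 ^ n ≤ q → √d * ψ q ≤ ε)
    (hsmall : (d + 1).factorial * (((2 : ℝ) ^ (n + 1)) ^ (d + 1) * ρ ^ d) < 1) :
    ∃ S : Finset (EuclideanSpace ℝ (Fin d)),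
      (∀ x ∈ K ∩ dyadicApprox d ψ n, ∃ y ∈ S, dist x y ≤ ε) ∧
      (S.card : ℝ) ≤ μ.real univ / (a * (ρ / 4) ^ δ) * (C * (2 * ε / ρ) ^ α * (b * ρ ^ δ)) /
        (a * (ε / 2) ^ δ) := by
  have hρ₀ : 0 < ρ := by linarith
  have hlow := fun x hx r h h' => (hmeas x hx r h h').1
  obtain ⟨T, hTK, hT, hTcard⟩ := exists_cover_card_le_measure_thickening ha hlow subset_rfl
    hK.totallyBounded (half_pos hρ₀) (by linarith)
  obtain ⟨S, -, hS, hScard⟩ := exists_cover_card_le_measure_thickening ha hlow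
    (inter_subset_left (s := K) (t := dyadicApprox d ψ n))
    (hK.totallyBounded.subset inter_subset_left) hε (by linarith)
  refine ⟨S, hS, hScard.trans ?_⟩
  choose L hLne hLdim hL using fun t : EuclideanSpace ℝ (Fin d) =>
    exists_hyperplane_of_cubeRationals hd t hsmall
  have hcover : thickening (ε / 2) (K ∩ dyadicApprox d ψ n) ⊆
      ⋃ t ∈ T, ball t ρ ∩ thickening (2 * ε) (L t : Set (EuclideanSpace ℝ (Fin d))) := by
    intro z hz
    obtain ⟨x, ⟨hxK, p, q, hq1, hq2, hpq⟩, hzx⟩ := mem_thickening_iff.mp hz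
    obtain ⟨t, ht, hxt⟩ := hT x hxK
    have hq0 : 0 < q := (pow_pos two_pos n).trans_le hq1
    set y : EuclideanSpace ℝ (Fin d) := WithLp.toLp 2 fun i => (p i : ℝ) / q with hy
    have hxy : dist x y ≤ ε :=
      (dist_le_sqrt_mul_of_forall_abs_sub_le (hψ₀ q) hpq).trans (hψ q hq1)
    have hyL : y ∈ L t := by
      have := hL t (Fin.cons (q : ℤ) p) ⟨by simpa using hq0, ?_, fun i => ?_⟩
      · simpa using this
      · simpa using (by exact_mod_cast hq2.le : (q : ℝ) ≤ 2 ^ (n + 1))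
      · have h1 := abs_sub_le_dist y t i
        have h2 := dist_triangle_left y t x
        simp only [Fin.cons_succ, Fin.cons_zero, Int.cast_natCast]
        simp only [hy] at h1
        linarith
    refine mem_iUnion₂.mpr ⟨t, ht, ?_, mem_thickening_iff.mpr ⟨y, hyL, ?_⟩⟩
    · rw [mem_ball]
      linarith [dist_triangle z x t]
    · linarith [dist_triangle z x y]
  have hpiece : ∀ t ∈ T, μ.real (ball t ρ ∩ thickening (2 * ε)
      (L t : Set (EuclideanSpace ℝ (Fin d)))) ≤ C * (2 * ε / ρ) ^ α * (b * ρ ^ δ) := by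
    intro t ht
    refine ENNReal.toReal_le_of_le_ofReal (by positivity) ?_
    rw [ENNReal.ofReal_mul (by positivity)]
    exact (hdec (L t) (hLne t) (hLdim t) (2 * ε) (by positivity) t (hTK ht) ρ hρ₀ hρ).trans
      (mul_le_mul_right (hmeas t (hTK ht) ρ hρ₀ hρ).2 _)
  have hmeasure : μ.real (thickening (ε / 2) (K ∩ dyadicApprox d ψ n)) ≤
      T.card * (C * (2 * ε / ρ) ^ α * (b * ρ ^ δ)) := by
    refine (measureReal_mono hcover (measure_ne_top _ _)).trans ((measureReal_biUnion_finset_le _ _).trans ?_)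
    simpa using Finset.sum_le_sum hpiece
  have hTcard' : (T.card : ℝ) ≤ μ.real univ / (a * (ρ / 4) ^ δ) := by
    refine hTcard.trans ?_
    rw [div_div, show (2 : ℝ) * 2 = 4 by norm_num]
    gcongr
    · exact measure_ne_top _ _
    · exact subset_univ _
  refine (div_le_div_of_nonneg_right hmeasure (by positivity)).trans ?_
  gcongr

end Covering

open Filter Topology in
/-- A compact set carrying a measure with a lower power bound has controlled dimension. -/
theorem hausdorffMeasure_eq_zero_of_lt_exponent {d : ℕ} {K : Set (EuclideanSpace ℝ (Fin d))}
    (hK : IsCompact K) (μ : Measure (EuclideanSpace ℝ (Fin d))) [IsFiniteMeasure μ]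
    {r₀ a δ : ℝ} (ha : 0 < a) (hr₀ : 0 < r₀)
    (hmeas : ∀ x ∈ K, ∀ r : ℝ, 0 < r → r < r₀ → ENNReal.ofReal (a * r ^ δ) ≤ μ (ball x r))
    {s : ℝ} (hs : 0 ≤ s) (hδs : δ < s) : Measure.hausdorffMeasure s K = 0 := by
  have hlim : Tendsto (fun n : ℕ => (1 / 2 : ℝ) ^ n) atTop (𝓝 0) :=
    tendsto_pow_atTop_nhds_zero_of_lt_one (by norm_num) (by norm_num)
  refine hausdorffMeasure_eq_zero_of_frequently_mem (A := fun _ => K)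
    (fun x hx => Frequently.of_forall fun _ => hx) (ε := fun n => (1 / 2 : ℝ) ^ n)
    (pow_right_anti₀ (by norm_num) (by norm_num)) (fun n => by positivity) hlim hs
    (M := μ.real univ / a * 2 ^ δ) (θ := (1 / 2 : ℝ) ^ (s - δ)) (by positivity)
    (Real.rpow_lt_one (by norm_num) (by norm_num) (by linarith)) ?_
  filter_upwards [hlim.eventually_lt_const hr₀] with n hn
  obtain ⟨S, -, hS, hcard⟩ := exists_cover_card_le_measure_thickening ha hmeas subset_rfl
    hK.totallyBounded (by positivity : (0 : ℝ) < (1 / 2) ^ n) hn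
  refine ⟨S, hS, ?_⟩
  have hcard' : (S.card : ℝ) ≤ μ.real univ / (a * ((1 / 2 : ℝ) ^ n / 2) ^ δ) := by
    refine hcard.trans ?_
    gcongr
    · exact measure_ne_top _ _
    · exact subset_univ _
  refine (mul_le_mul_of_nonneg_right hcard' (by positivity)).trans_eq ?_
  rw [← Real.rpow_mul_natCast (by norm_num), mul_comm (s - δ), Real.rpow_mul (by norm_num),
    Real.rpow_natCast, Real.rpow_sub (by positivity), Real.div_rpow (by positivity) zero_le_two]
  field_simp

open Filter Topology in
/-- The Hausdorff measure estimate above the critical approximation exponent `(d + 1) / d`. -/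
theorem hausdorffMeasure_inter_wellApprox_eq_zero {d : ℕ} (hd : 0 < d)
    {K : Set (EuclideanSpace ℝ (Fin d))} (hK : IsCompact K)
    (μ : Measure (EuclideanSpace ℝ (Fin d))) [IsFiniteMeasure μ] {C α r₀ a b δ : ℝ} (hC : 0 < C)
    (hr₀ : 0 < r₀) (ha : 0 < a) (hb : 0 < b) (hdec : IsAbsolutelyDecaying d K μ C α r₀)
    (hmeas : ∀ x ∈ K, ∀ r : ℝ, 0 < r → r < r₀ →
      ENNReal.ofReal (a * r ^ δ) ≤ μ (ball x r) ∧ μ (ball x r) ≤ ENNReal.ofReal (b * r ^ δ))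
    {τ s : ℝ} (hτ : ((d : ℝ) + 1) / d < τ) (hs : 0 ≤ s)
    (hsδ : δ - α * (1 - ((d : ℝ) + 1) / (τ * d)) < s) :
    Measure.hausdorffMeasure s (K ∩ WellApprox d (fun r => r ^ (-τ))) = 0 := by
  have hd' : (0 : ℝ) < d := by exact_mod_cast hd
  have hτ₀ : 0 < τ := lt_trans (by positivity) hτ
  set κ : ℝ := ((d : ℝ) + 1) / d with hκ
  have hκ₀ : 0 < κ := by positivity
  set u : ℝ := 2 ^ (-τ) with hu
  set v : ℝ := 2 ^ (-κ) with hv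
  have hu₀ : 0 < u := by positivity
  have hv₀ : 0 < v := by positivity
  have hu₁ : u < 1 := Real.rpow_lt_one_of_one_lt_of_neg one_lt_two (by linarith)
  have hv₁ : v < 1 := Real.rpow_lt_one_of_one_lt_of_neg one_lt_two (by linarith)
  have huv : u < v := Real.rpow_lt_rpow_of_exponent_lt one_lt_two (by linarith)
  obtain ⟨c, hc₀, hc⟩ : ∃ c : ℝ, 0 < c ∧ (d + 1).factorial * (2 ^ (d + 1) * c ^ d) < 1 := by
    have hcont : Tendsto (fun c : ℝ => ((d + 1).factorial : ℝ) * (2 ^ (d + 1) * c ^ d))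
        (𝓝[>] 0) (𝓝 0) := by
      have : Continuous fun c : ℝ => ((d + 1).factorial : ℝ) * (2 ^ (d + 1) * c ^ d) := by
        fun_prop
      simpa [hd.ne'] using (this.tendsto 0).mono_left nhdsWithin_le_nhds
    obtain ⟨c, h1, h2⟩ := ((hcont.eventually_lt_const one_pos).and self_mem_nhdsWithin).exists
    exact ⟨c, h2, h1⟩
  have hvd : v ^ d * 2 ^ (d + 1) = 1 := by
    rw [hv, ← Real.rpow_mul_natCast zero_le_two, ← Real.rpow_natCast 2 (d + 1),
      ← Real.rpow_add two_pos, hκ]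
    push_cast
    rw [neg_mul, div_mul_cancel₀ _ hd'.ne', neg_add_cancel, Real.rpow_zero]
  have hsqrt : 0 < √(d : ℝ) := Real.sqrt_pos.mpr hd'
  have hlim_u : Tendsto (fun n : ℕ => √d * u ^ n) atTop (𝓝 0) := by
    simpa using (tendsto_pow_atTop_nhds_zero_of_lt_one hu₀.le hu₁).const_mul √(d : ℝ)
  have hlim_v : Tendsto (fun n : ℕ => c * v ^ n) atTop (𝓝 0) := by
    simpa using (tendsto_pow_atTop_nhds_zero_of_lt_one hv₀.le hv₁).const_mul c
  have hlim_uv : Tendsto (fun n : ℕ => 4 * √d * (u / v) ^ n) atTop (𝓝 0) := by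
    simpa using (tendsto_pow_atTop_nhds_zero_of_lt_one (by positivity)
      ((div_lt_one hv₀).mpr huv)).const_mul (4 * √(d : ℝ))
  have hθ : u ^ (s - δ + α) * v ^ (-α) < 1 := by
    rw [hu, hv, ← Real.rpow_mul zero_le_two, ← Real.rpow_mul zero_le_two, ← Real.rpow_add two_pos]
    refine Real.rpow_lt_one_of_one_lt_of_neg one_lt_two ?_
    have h1 : ((d : ℝ) + 1) / (τ * d) = κ / τ := by
      rw [hκ]
      field_simp
    rw [h1] at hsδ
    have h2 : τ * (α * (κ / τ)) < τ * (s - δ + α) :=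
      mul_lt_mul_of_pos_left (by linarith) hτ₀
    have h3 : τ * (α * (κ / τ)) = α * κ := by field_simp
    linarith
  refine hausdorffMeasure_eq_zero_of_frequently_mem
    (A := fun n => K ∩ dyadicApprox d (fun r => r ^ (-τ)) n)
    (fun x hx => (frequently_mem_dyadicApprox hx.2).mono fun n hn => ⟨hx.1, hn⟩)
    (ε := fun n => √d * u ^ n)
    (fun m n hmn => mul_le_mul_of_nonneg_left (pow_right_anti₀ hu₀.le hu₁.le hmn) hsqrt.le)
    (fun n => by positivity) hlim_u hs
    (M := μ.real univ * 4 ^ δ * C * 2 ^ α * b * 2 ^ δ / a ^ 2 *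
      (√d ^ (s - δ + α) * c ^ (-α))) (θ := u ^ (s - δ + α) * v ^ (-α)) (by positivity) hθ ?_
  filter_upwards [hlim_v.eventually_lt_const hr₀, hlim_uv.eventually_le_const hc₀] with n hn₁ hn₂
  have hε : 0 < √d * u ^ n := by positivity
  have hρ : 0 < c * v ^ n := by positivity
  have hερ : 4 * (√d * u ^ n) ≤ c * v ^ n := by
    rw [div_pow, mul_div_assoc', div_le_iff₀ (by positivity)] at hn₂
    linarith
  have hψ : ∀ q : ℕ, 2 ^ n ≤ q → √d * (q : ℝ) ^ (-τ) ≤ √d * u ^ n := by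
    intro q hq
    have hq' : (2 : ℝ) ^ n ≤ q := by exact_mod_cast hq
    have : (q : ℝ) ^ (-τ) ≤ u ^ n := by
      rw [hu, Real.rpow_pow_comm zero_le_two]
      exact Real.rpow_le_rpow_of_nonpos (by positivity) hq' (by linarith)
    exact mul_le_mul_of_nonneg_left this hsqrt.le
  have hsmall : (d + 1).factorial * (((2 : ℝ) ^ (n + 1)) ^ (d + 1) * (c * v ^ n) ^ d) < 1 := by
    convert hc using 2
    calc ((2 : ℝ) ^ (n + 1)) ^ (d + 1) * (c * v ^ n) ^ d
        = 2 ^ (d + 1) * c ^ d * (v ^ d * 2 ^ (d + 1)) ^ n := by ring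
      _ = _ := by rw [hvd, one_pow, mul_one]
  obtain ⟨S, hS, hcard⟩ := exists_cover_dyadicApprox (ψ := fun r => r ^ (-τ)) hd hK hC ha hb hdec
    hmeas hε hερ hn₁ (fun q => by positivity) hψ hsmall
  refine ⟨S, hS, (mul_le_mul_of_nonneg_right hcard (by positivity)).trans_eq ?_⟩
  have hpow_ε : (√d * u ^ n) ^ (s - δ + α) = √d ^ (s - δ + α) * (u ^ (s - δ + α)) ^ n := by
    rw [Real.mul_rpow hsqrt.le (by positivity), Real.rpow_pow_comm hu₀.le]
  have hpow_ρ : (c * v ^ n) ^ (-α) = c ^ (-α) * (v ^ (-α)) ^ n := by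
    rw [Real.mul_rpow hc₀.le (by positivity), Real.rpow_pow_comm hv₀.le]
  have hrhs : √d ^ (s - δ + α) * c ^ (-α) * (u ^ (s - δ + α) * v ^ (-α)) ^ n =
      (√d * u ^ n) ^ (s - δ + α) * (c * v ^ n) ^ (-α) := by
    rw [hpow_ε, hpow_ρ, mul_pow]
    ring
  rw [mul_assoc _ (_ * _) (_ ^ n), hrhs]
  generalize √d * u ^ n = ε at hε
  generalize c * v ^ n = ρ at hρ
  rw [Real.rpow_add hε, Real.rpow_sub hε, Real.rpow_neg hρ.le, Real.div_rpow hρ.le (by norm_num),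
    Real.div_rpow (by positivity) hρ.le, Real.div_rpow hε.le zero_le_two,
    Real.mul_rpow zero_le_two hε.le]
  field_simp

/-- Dimension bound for W(τ): dim (K ∩ W(τ)) ≤ δ - α(1 - (d+1)/(τ d)). -/
theorem stmt_7 (d : ℕ) (hd : 0 < d) (K : Set (EuclideanSpace ℝ (Fin d)))
    (hK : IsCompact K) (μ : Measure (EuclideanSpace ℝ (Fin d))) [IsFiniteMeasure μ]
    (hsupp : μ Kᶜ = 0)
    (C D α r₀ a b δ : ℝ) (hC : 0 < C) (hD : 0 < D) (hα : 0 < α) (hr₀ : 0 < r₀)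
    (ha : 0 < a) (hb : 0 < b) (hδ : 0 < δ)
    (hdbl : IsDoubling d K μ D r₀) (hdec : IsAbsolutelyDecaying d K μ C α r₀)
    (hmeas : ∀ x ∈ K, ∀ r : ℝ, 0 < r → r < r₀ →
      ENNReal.ofReal (a * r ^ δ) ≤ μ (ball x r) ∧
        μ (ball x r) ≤ ENNReal.ofReal (b * r ^ δ))
    (τ : ℝ) (hτ : ((d : ℝ) + 1) / d ≤ τ) :
    dimH (K ∩ WellApprox d (fun r => r ^ (-τ))) ≤
      ENNReal.ofReal (δ - α * (1 - ((d : ℝ) + 1) / (τ * d))) := by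
  refine dimH_le fun s hs => ?_
  by_contra! hlt
  refine ENNReal.zero_ne_top (hs.symm.trans ?_).symm
  have hs' : δ - α * (1 - ((d : ℝ) + 1) / (τ * d)) < s := by
    by_contra! h
    exact hlt.not_ge (by simpa using ENNReal.ofReal_le_ofReal h)
  rcases hτ.lt_or_eq with hτ | rfl
  · exact hausdorffMeasure_inter_wellApprox_eq_zero hd hK μ hC hr₀ ha hb hdec hmeas hτ s.2 hs'
  · have hd' : (0 : ℝ) < d := by exact_mod_cast hd
    rw [div_mul_cancel₀ _ hd'.ne', div_self (by positivity), sub_self, mul_zero, sub_zero] at hs'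
    exact measure_mono_null inter_subset_left (hausdorffMeasure_eq_zero_of_lt_exponent hK μ ha hr₀
      (fun x hx r h h' => (hmeas x hx r h h').1) s.2 hs')
end
end

section
/- Let K be a compact subset of ℝ^d equipped with an absolutely α-friendly measure μ satisfying a·r^δ ≤ μ(B(x,r)) ≤ b·r^δ for x ∈ K, r < r₀, and let τ > (d+1)/d. Then μ(K ∩ W(τ)) = 0, where W(τ) = {x ∈ ℝ^d : max_i |x_i − p_i/q| ≤ q^{−τ} for infinitely many (p,q) ∈ ℤ^d × ℕ}. -/
open MeasureTheory Metric Set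

noncomputable section

open scoped ENNReal NNReal

/-- The point `p / q` of `ℝ^d` with integer numerators `p` and common denominator `q`. -/
def ratPoint {d : ℕ} (pq : (Fin d → ℤ) × ℕ) : EuclideanSpace ℝ (Fin d) :=
  WithLp.toLp 2 fun i => (pq.1 i : ℝ) / (pq.2 : ℝ)

@[simp] lemma ratPoint_apply {d : ℕ} (pq : (Fin d → ℤ) × ℕ) (i : Fin d) :
    ratPoint pq i = (pq.1 i : ℝ) / (pq.2 : ℝ) := rfl

/-- Clearing denominators in the determinant of differences of `d + 1` rational points. -/
lemma exists_int_eq_prod_mul_det {d : ℕ} (x₀ : (Fin d → ℤ) × ℕ) (x : Fin d → (Fin d → ℤ) × ℕ)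
    (h₀ : 0 < x₀.2) (hx : ∀ i, 0 < (x i).2) :
    ∃ m : ℤ, (m : ℝ) = (x₀.2 : ℝ) * ((∏ i, ((x i).2 : ℝ)) *
      (Matrix.of fun i j => ratPoint (x i) j - ratPoint x₀ j).det) := by
  let A : Matrix Unit Unit ℤ := Matrix.of fun _ _ => (x₀.2 : ℤ)
  let B : Matrix Unit (Fin d) ℤ := Matrix.of fun _ j => x₀.1 j
  let E : Matrix (Fin d) Unit ℤ := Matrix.of fun i _ => ((x i).2 : ℤ)
  let F : Matrix (Fin d) (Fin d) ℤ := Matrix.of fun i j => (x i).1 j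
  refine ⟨(Matrix.fromBlocks A B E F).det, ?_⟩
  have h₀' : (x₀.2 : ℝ) ≠ 0 := by positivity
  let A' : Matrix Unit Unit ℝ := Matrix.of fun _ _ => (x₀.2 : ℝ)
  let I' : Matrix Unit Unit ℝ := Matrix.of fun _ _ => (x₀.2 : ℝ)⁻¹
  let _ : Invertible A' := ⟨I', by ext; simp [A', I', Matrix.mul_apply, h₀'],
    by ext; simp [A', I', Matrix.mul_apply, h₀']⟩
  have hmap : (Matrix.fromBlocks A B E F).map (Int.cast : ℤ → ℝ) =
      Matrix.fromBlocks A' (B.map Int.cast) (E.map Int.cast) (F.map Int.cast) := by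
    rw [Matrix.fromBlocks_map]
    congr 1
  have hcast : (((Matrix.fromBlocks A B E F).det : ℤ) : ℝ) =
      ((Matrix.fromBlocks A B E F).map (Int.cast : ℤ → ℝ)).det :=
    (Int.castRingHom ℝ).map_det _
  rw [hcast, hmap, Matrix.det_fromBlocks₁₁, ← Matrix.det_mul_column]
  congr 1
  · simp [A']
  · congr 1
    ext i j
    have hi : ((x i).2 : ℝ) ≠ 0 := by have := hx i; positivity
    have : ⅟A' = I' := rfl
    simp only [this, Matrix.sub_apply, Matrix.mul_apply, I', E, F, B]
    simp
    field_simp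

/-- The determinant of differences of `d + 1` rational points that are close to one another
relative to their denominators vanishes. -/
lemma det_sub_ratPoint_eq_zero {d : ℕ} {N s : ℝ} (hsmall : d.factorial * s ^ d * N ^ (d + 1) < 1)
    (x₀ : (Fin d → ℤ) × ℕ) (x : Fin d → (Fin d → ℤ) × ℕ)
    (h₀ : 0 < x₀.2) (hx : ∀ i, 0 < (x i).2) (h₀N : (x₀.2 : ℝ) ≤ N) (hxN : ∀ i, ((x i).2 : ℝ) ≤ N)
    (hdist : ∀ i j, |ratPoint (x i) j - ratPoint x₀ j| ≤ s) :
    (Matrix.of fun i j => ratPoint (x i) j - ratPoint x₀ j).det = 0 := by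
  obtain ⟨m, hm⟩ := exists_int_eq_prod_mul_det x₀ x h₀ hx
  set Δ := (Matrix.of fun i j => ratPoint (x i) j - ratPoint x₀ j).det
  have hΔle : |Δ| ≤ d.factorial * s ^ d := by
    have := Matrix.det_le (A := Matrix.of fun i j => ratPoint (x i) j - ratPoint x₀ j)
      (abv := (AbsoluteValue.abs : AbsoluteValue ℝ ℝ)) (x := s) hdist
    rwa [Fintype.card_fin, nsmul_eq_mul] at this
  have hprod : ∏ i, ((x i).2 : ℝ) ≤ N ^ d := by
    simpa using Finset.prod_le_prod (s := Finset.univ) (fun i _ => (x i).2.cast_nonneg (α := ℝ))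
      fun i _ => hxN i
  have hN : 0 ≤ N := h₀N.trans' (by positivity)
  have hprod0 : 0 ≤ ∏ i, ((x i).2 : ℝ) := by positivity
  have hm1 : |(m : ℝ)| < 1 := by
    rw [hm, abs_mul, abs_mul, abs_of_nonneg hprod0, Nat.abs_cast]
    calc (x₀.2 : ℝ) * ((∏ i, ((x i).2 : ℝ)) * |Δ|) ≤ N * (N ^ d * (d.factorial * s ^ d)) := by
          gcongr
      _ = d.factorial * s ^ d * N ^ (d + 1) := by ring
      _ < 1 := hsmall
  have hm0 : m = 0 := by
    rw [← Int.abs_lt_one_iff]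
    exact_mod_cast hm1
  have hx0 : (x₀.2 : ℝ) ≠ 0 := by positivity
  have hxi : ∏ i, ((x i).2 : ℝ) ≠ 0 :=
    Finset.prod_ne_zero_iff.2 fun i _ => by have := hx i; positivity
  rw [hm0, Int.cast_zero, eq_comm] at hm
  simpa [hx0, hxi] using hm

/-- The simplex lemma: rational points that are close to one another relative to their
denominators lie on a common affine hyperplane. -/
lemma exists_hyperplane_of_ratPoint {d : ℕ} (hd : 0 < d) {N s : ℝ}
    (hsmall : d.factorial * s ^ d * N ^ (d + 1) < 1) (P : Set ((Fin d → ℤ) × ℕ))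
    (hpos : ∀ x ∈ P, 0 < x.2) (hN : ∀ x ∈ P, (x.2 : ℝ) ≤ N)
    (hdist : ∀ x ∈ P, ∀ y ∈ P, ∀ j, |ratPoint x j - ratPoint y j| ≤ s) :
    ∃ L : AffineSubspace ℝ (EuclideanSpace ℝ (Fin d)),
      (L : Set (EuclideanSpace ℝ (Fin d))).Nonempty ∧ Module.finrank ℝ L.direction = d - 1 ∧
        ∀ x ∈ P, ratPoint x ∈ L := by
  have key : ∃ x₀ : EuclideanSpace ℝ (Fin d),
      Submodule.span ℝ ((fun x => ratPoint x - x₀) '' P) ≠ ⊤ := by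
    rcases P.eq_empty_or_nonempty with rfl | ⟨x₀, hx₀⟩
    · have : Nonempty (Fin d) := ⟨⟨0, hd⟩⟩
      exact ⟨0, by simp⟩
    refine ⟨ratPoint x₀, fun htop => ?_⟩
    obtain ⟨t, ht, htcard, -, hli⟩ := Submodule.exists_finset_span_eq_linearIndepOn ℝ
      ((fun x => ratPoint x - ratPoint x₀) '' P)
    rw [htop, finrank_top, finrank_euclideanSpace_fin] at htcard
    let e : Fin d ≃ t := (t.equivFinOfCardEq htcard).symm
    choose x hxP hx using fun i => ht (e i).2
    have hli' : LinearIndependent ℝ fun i => ratPoint (x i) - ratPoint x₀ := by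
      simp only [hx]
      exact LinearIndependent.comp hli e e.injective
    have hrow := (hli'.map' (WithLp.linearEquiv 2 ℝ (Fin d → ℝ)).toLinearMap
      (LinearEquiv.ker _))
    have hunit : IsUnit (Matrix.of fun i j => ratPoint (x i) j - ratPoint x₀ j) :=
      Matrix.linearIndependent_rows_iff_isUnit.1 hrow
    rw [Matrix.isUnit_iff_isUnit_det, isUnit_iff_ne_zero] at hunit
    exact hunit (det_sub_ratPoint_eq_zero hsmall x₀ x (hpos _ hx₀) (fun i => hpos _ (hxP i))
      (hN _ hx₀) (fun i => hN _ (hxP i)) fun i j => hdist _ (hxP i) _ hx₀ j)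
  obtain ⟨x₀, hspan⟩ := key
  obtain ⟨f, hf, hle⟩ := Submodule.exists_le_ker_of_lt_top _ (lt_top_iff_ne_top.2 hspan)
  refine ⟨AffineSubspace.mk' x₀ (LinearMap.ker f), ⟨x₀, AffineSubspace.self_mem_mk' _ _⟩, ?_, ?_⟩
  · have := Module.Dual.finrank_ker_add_one_of_ne_zero (f := f) hf
    rw [finrank_euclideanSpace_fin] at this
    rw [AffineSubspace.direction_mk']
    omega
  · intro x hx
    rw [AffineSubspace.mem_mk']
    exact hle (Submodule.subset_span ⟨x, hx, rfl⟩)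

/-- A bound on `μ A` from bounds on balls of a fixed radius centred in a set containing `A`. -/
lemma measure_le_of_forall_ball {X : Type*} [MetricSpace X] [SecondCountableTopology X]
    [MeasurableSpace X] [BorelSpace X] (μ : Measure X) {K A : Set X} (hAK : A ⊆ K) {ρ : ℝ}
    (hρ : 0 < ρ) {c D : ℝ≥0∞}
    (hA : ∀ x ∈ K, μ (A ∩ ball x (4 * ρ)) ≤ c * μ (ball x (4 * ρ)))
    (hD : ∀ x ∈ K, μ (ball x (4 * ρ)) ≤ D * μ (ball x ρ)) :
    μ A ≤ c * D * μ univ := by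
  lift ρ to ℝ≥0 using hρ.le
  obtain ⟨N, hN⟩ : ∃ N, Maximal (fun N ↦ N ⊆ K ∧ IsSeparated (2 * ρ : ℝ≥0) N) N := by
    have := zorn_subset {N | N ⊆ K ∧ IsSeparated (2 * ρ : ℝ≥0) N} fun c hc hchain =>
      ⟨⋃₀ c, ⟨sUnion_subset fun s hs => (hc hs).1,
        (pairwise_sUnion hchain.directedOn).2 fun s hs => (hc hs).2⟩,
        fun s hs => subset_sUnion_of_mem hs⟩
    exact this
  have hNK := hN.prop.1
  have hcover := isCover_iff_subset_iUnion_closedBall.1 (IsCover.of_maximal_isSeparated hN)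
  have hdisj : N.PairwiseDisjoint fun x => ball x (ρ : ℝ) := by
    intro x hx y hy hxy
    have h : ((2 * ρ : ℝ≥0) : ℝ≥0∞) < edist x y := hN.prop.2 hx hy hxy
    rw [edist_nndist, ENNReal.coe_lt_coe, ← NNReal.coe_lt_coe, coe_nndist] at h
    refine ball_disjoint_ball ?_
    push_cast at h
    linarith
  have hcount : N.Countable := hdisj.countable_of_isOpen (fun _ _ => isOpen_ball)
    fun x _ => ⟨x, mem_ball_self hρ⟩
  have hsub : A ⊆ ⋃ x ∈ N, A ∩ ball x (4 * ρ) := by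
    intro y hy
    obtain ⟨x, hx, hyx⟩ := mem_iUnion₂.1 (hcover (hAK hy))
    refine mem_iUnion₂.2 ⟨x, hx, hy, closedBall_subset_ball ?_ hyx⟩
    push_cast
    linarith
  calc μ A ≤ ∑' x : N, μ (A ∩ ball x (4 * ρ)) :=
        (measure_mono hsub).trans (measure_biUnion_le μ hcount _)
    _ ≤ ∑' x : N, c * D * μ (ball x ρ) := by
        refine ENNReal.tsum_le_tsum fun x => (hA x (hNK x.2)).trans ?_
        rw [mul_assoc]
        gcongr
        exact hD x (hNK x.2)
    _ = c * D * μ (⋃ x ∈ N, ball x ρ) := by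
        rw [ENNReal.tsum_mul_left, measure_biUnion hcount hdisj fun _ _ => measurableSet_ball]
    _ ≤ c * D * μ univ := by gcongr; exact subset_univ _

/-- The Euclidean distance is at most `d` times the sup distance. -/
lemma dist_le_of_forall_abs_sub_le {d : ℕ} {x y : EuclideanSpace ℝ (Fin d)} {s : ℝ}
    (h : ∀ i, |x i - y i| ≤ s) : dist x y ≤ d * s := by
  rw [EuclideanSpace.dist_eq]
  calc √(∑ i, dist (x i) (y i) ^ 2) ≤ ∑ i, dist (x i) (y i) := by
        exact Real.sqrt_le_iff.2 ⟨Finset.sum_nonneg fun i _ => dist_nonneg,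
          Finset.sum_sq_le_sq_sum_of_nonneg fun i _ => dist_nonneg⟩
    _ ≤ d * s := by
        simpa using Finset.sum_le_card_nsmul Finset.univ (fun i => dist (x i) (y i)) s
          fun i _ => by simpa [Real.dist_eq] using h i

/-- Measure of the set of points of `K` that are `η`-close to a rational point of denominator
at most `N`, when `N` is small relative to the scale `ρ`. -/
lemma measure_near_ratPoint_le {d : ℕ} (hd : 0 < d) {K : Set (EuclideanSpace ℝ (Fin d))}
    {μ : Measure (EuclideanSpace ℝ (Fin d))} {C D α r₀ : ℝ}
    (hdbl : IsDoubling d K μ D r₀) (hdec : IsAbsolutelyDecaying d K μ C α r₀)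
    {N ρ η ε : ℝ} (hρ : 0 < ρ) (hρr : 4 * ρ < r₀) (hε : 0 < ε) (hηε : d * η < ε)
    (hερ : ε ≤ 4 * ρ) (hsmall : d.factorial * (16 * ρ) ^ d * N ^ (d + 1) < 1) :
    μ {y ∈ K | ∃ x : (Fin d → ℤ) × ℕ, 0 < x.2 ∧ (x.2 : ℝ) ≤ N ∧
        ∀ i, |y i - ratPoint x i| ≤ η} ≤
      ENNReal.ofReal (C * (ε / (4 * ρ)) ^ α) * (ENNReal.ofReal D * ENNReal.ofReal D) *
        μ univ := by
  refine measure_le_of_forall_ball μ (sep_subset _ _) hρ (fun z hz => ?_) fun z hz => ?_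
  · let P : Set ((Fin d → ℤ) × ℕ) :=
      {x | 0 < x.2 ∧ (x.2 : ℝ) ≤ N ∧ dist (ratPoint x) z ≤ 8 * ρ}
    obtain ⟨L, hLne, hLrank, hL⟩ := exists_hyperplane_of_ratPoint hd hsmall P
      (fun x hx => hx.1) (fun x hx => hx.2.1) fun x hx y hy j => by
        have h₁ := PiLp.norm_apply_le (ratPoint x - ratPoint y) j
        have h₂ := dist_triangle_right (ratPoint x) (ratPoint y) z
        rw [← dist_eq_norm] at h₁
        simp only [PiLp.sub_apply, Real.norm_eq_abs] at h₁
        linarith [hx.2.2, hy.2.2]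
    refine (measure_mono ?_).trans (hdec L hLne hLrank ε hε z hz (4 * ρ) (by positivity) hρr)
    rintro y ⟨⟨-, x, hx0, hxN, hyx⟩, hyz⟩
    have hdist := dist_le_of_forall_abs_sub_le hyx
    refine ⟨hyz, mem_thickening_iff.2 ⟨ratPoint x, hL x ⟨hx0, hxN, ?_⟩, by linarith⟩⟩
    have := dist_triangle_left (ratPoint x) z y
    linarith [mem_ball.1 hyz]
  · calc μ (ball z (4 * ρ)) = μ (ball z (2 * (2 * ρ))) := by ring_nf
      _ ≤ ENNReal.ofReal D * μ (ball z (2 * ρ)) :=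
        hdbl z hz _ (by positivity) (by linarith)
      _ ≤ ENNReal.ofReal D * (ENNReal.ofReal D * μ (ball z ρ)) := by
        gcongr
        exact hdbl z hz _ hρ (by linarith)
      _ = _ := (mul_assoc _ _ _).symm

/-- A well approximable point has approximations with arbitrarily large denominators. -/
lemma exists_le_denom_of_mem_wellApprox {d : ℕ} {τ : ℝ} (hτ : 0 < τ)
    {x : EuclideanSpace ℝ (Fin d)} (hx : x ∈ WellApprox d fun r => r ^ (-τ)) (M : ℕ) :
    ∃ pq : (Fin d → ℤ) × ℕ, 0 < pq.2 ∧ M ≤ pq.2 ∧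
      ∀ i, |x i - ratPoint pq i| ≤ (pq.2 : ℝ) ^ (-τ) := by
  by_contra! hcon
  let B : ℤ := ⌈(M : ℝ) * (‖x‖ + 1)⌉
  refine hx (((finite_Icc (fun _ => -B) fun _ => B).prod (finite_Iio M)).subset ?_)
  rintro ⟨p, q⟩ ⟨hq, hpq⟩
  simp only at hq hpq
  have hqM : q < M := by
    by_contra! h
    obtain ⟨i, hi⟩ := hcon (p, q) hq h
    exact hi.not_ge (hpq i)
  have hp : ∀ i, |p i| ≤ B := by
    intro i
    have hq1 : (1 : ℝ) ≤ q := by exact_mod_cast hq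
    have h₁ : |(p i : ℝ) / q| ≤ ‖x‖ + 1 := by
      have h₂ := (hpq i).trans (Real.rpow_le_one_of_one_le_of_nonpos hq1 (by linarith))
      have h₃ : |x i| ≤ ‖x‖ := PiLp.norm_apply_le x i
      have h₄ := abs_sub_abs_le_abs_sub ((p i : ℝ) / q) (x i)
      rw [abs_sub_comm] at h₄
      linarith
    rw [abs_div, Nat.abs_cast, div_le_iff₀ (by positivity)] at h₁
    have h₅ : |(p i : ℝ)| ≤ B := by
      refine (h₁.trans ?_).trans (Int.le_ceil _)
      rw [mul_comm]
      have : (q : ℝ) ≤ M := by exact_mod_cast hqM.le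
      gcongr
    exact_mod_cast h₅
  exact ⟨⟨fun i => (abs_le.1 (hp i)).1, fun i => (abs_le.1 (hp i)).2⟩, hqM⟩

/-- A well approximable point is, for infinitely many `n`, close to a rational point whose
denominator lies in the `n`-th dyadic block. -/
lemma frequently_of_mem_wellApprox {d : ℕ} {τ : ℝ} (hτ : 0 < τ)
    {x : EuclideanSpace ℝ (Fin d)} (hx : x ∈ WellApprox d fun r => r ^ (-τ)) :
    ∃ᶠ n : ℕ in Filter.atTop, ∃ pq : (Fin d → ℤ) × ℕ, 0 < pq.2 ∧ (pq.2 : ℝ) ≤ 2 ^ (n + 1) ∧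
      ∀ i, |x i - ratPoint pq i| ≤ ((2 : ℝ) ^ (-τ)) ^ n := by
  refine Filter.frequently_atTop.2 fun m => ?_
  obtain ⟨pq, hpos, hm, hpq⟩ := exists_le_denom_of_mem_wellApprox hτ hx (2 ^ m)
  refine ⟨Nat.log 2 pq.2, (Nat.le_log_iff_pow_le one_lt_two hpos.ne').2 hm, pq, hpos, ?_,
    fun i => (hpq i).trans ?_⟩
  · exact_mod_cast (Nat.lt_pow_succ_log_self one_lt_two pq.2).le
  · have h : ((2 : ℝ) ^ Nat.log 2 pq.2) ≤ pq.2 := by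
      exact_mod_cast Nat.pow_log_le_self 2 hpos.ne'
    rw [← Real.rpow_natCast, ← Real.rpow_mul two_pos.le, mul_comm (-τ), Real.rpow_mul two_pos.le,
      Real.rpow_natCast]
    exact Real.rpow_le_rpow_of_nonpos (by positivity) h (by linarith)

/-- A scale constant for which the smallness condition of the simplex lemma holds at all
dyadic heights. -/
lemma exists_pos_scale {d : ℕ} (hd : 0 < d) :
    ∃ c : ℝ, 0 < c ∧ d.factorial * (16 * c) ^ d * 2 ^ (d + 1) < 1 := by
  have hA : (0 : ℝ) < d.factorial * 2 ^ (d + 1) := by positivity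
  have hA1 : (1 : ℝ) ≤ d.factorial * 2 ^ (d + 1) :=
    one_le_mul_of_one_le_of_one_le (by exact_mod_cast d.factorial_pos)
      (one_le_pow₀ one_le_two)
  set A : ℝ := d.factorial * 2 ^ (d + 1)
  refine ⟨(2 * A)⁻¹ / 16, by positivity, ?_⟩
  have h : (2 * A)⁻¹ ^ d ≤ (2 * A)⁻¹ :=
    pow_le_of_le_one (by positivity) (inv_le_one_of_one_le₀ (by linarith)) hd.ne'
  calc d.factorial * (16 * ((2 * A)⁻¹ / 16)) ^ d * 2 ^ (d + 1) = A * (2 * A)⁻¹ ^ d := by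
        rw [mul_div_cancel₀ _ (by norm_num)]; ring
    _ ≤ A * (2 * A)⁻¹ := by gcongr
    _ = 1 / 2 := by field_simp
    _ < 1 := by norm_num

/-- Corollary: for τ > (d+1)/d and an absolutely α-friendly measure satisfying
the Ahlfors-type condition, μ(K ∩ W(τ)) = 0. -/
theorem stmt_17 (d : ℕ) (hd : 0 < d) (K : Set (EuclideanSpace ℝ (Fin d)))
    (hK : IsCompact K) (μ : Measure (EuclideanSpace ℝ (Fin d))) [IsFiniteMeasure μ]
    (hsupp : μ Kᶜ = 0)
    (C D α r₀ a b δ : ℝ) (hC : 0 < C) (hD : 0 < D) (hα : 0 < α) (hr₀ : 0 < r₀)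
    (ha : 0 < a) (hb : 0 < b) (hδ : 0 < δ)
    (hdbl : IsDoubling d K μ D r₀) (hdec : IsAbsolutelyDecaying d K μ C α r₀)
    (hmeas : ∀ x ∈ K, ∀ r : ℝ, 0 < r → r < r₀ →
      ENNReal.ofReal (a * r ^ δ) ≤ μ (ball x r) ∧
        μ (ball x r) ≤ ENNReal.ofReal (b * r ^ δ))
    (τ : ℝ) (hτ : ((d : ℝ) + 1) / d < τ) :
    μ (K ∩ WellApprox d (fun r => r ^ (-τ))) = 0 := by
  have hd' : (0 : ℝ) < d := by exact_mod_cast hd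
  set σ : ℝ := ((d : ℝ) + 1) / d with hσ
  have hσ0 : 0 < σ := by positivity
  have hτ0 : 0 < τ := hσ0.trans hτ
  obtain ⟨c, hc, hcsmall⟩ := exists_pos_scale hd
  set u : ℝ := 2 ^ (-σ) with hu
  set θ : ℝ := 2 ^ (σ - τ) with hθ
  have hu0 : 0 < u := by positivity
  have hθ0 : 0 < θ := by positivity
  have hu1 : u < 1 := Real.rpow_lt_one_of_one_lt_of_neg one_lt_two (by linarith)
  have hθ1 : θ < 1 := Real.rpow_lt_one_of_one_lt_of_neg one_lt_two (by linarith)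
  have huθ : u * θ = 2 ^ (-τ) := by
    rw [hu, hθ, ← Real.rpow_add two_pos]
    ring_nf
  have hud : u ^ d * 2 ^ (d + 1) = 1 := by
    rw [hu, ← Real.rpow_natCast, ← Real.rpow_mul two_pos.le, ← Real.rpow_natCast,
      ← Real.rpow_add two_pos, hσ]
    have : -(((d : ℝ) + 1) / d) * d + ((d + 1 : ℕ) : ℝ) = 0 := by
      push_cast
      field_simp
      ring
    rw [this, Real.rpow_zero]
  set k : ℝ := d / (2 * c) with hk
  have hk0 : 0 < k := by positivity
  let E : ℕ → Set (EuclideanSpace ℝ (Fin d)) := fun n => {y ∈ K | ∃ x : (Fin d → ℤ) × ℕ,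
    0 < x.2 ∧ (x.2 : ℝ) ≤ 2 ^ (n + 1) ∧ ∀ i, |y i - ratPoint x i| ≤ ((2 : ℝ) ^ (-τ)) ^ n}
  have hbound : ∀ᶠ n in Filter.atTop, μ (E n) ≤
      ENNReal.ofReal (C * k ^ α * (θ ^ α) ^ n) *
        (ENNReal.ofReal D * ENNReal.ofReal D * μ univ) := by
    have hlim₁ : Filter.Tendsto (fun n : ℕ => 4 * (c * u ^ n)) Filter.atTop (nhds 0) := by
      simpa using ((tendsto_pow_atTop_nhds_zero_of_lt_one hu0.le hu1).const_mul c).const_mul 4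
    have hlim₂ : Filter.Tendsto (fun n : ℕ => k * θ ^ n) Filter.atTop (nhds 0) := by
      simpa using (tendsto_pow_atTop_nhds_zero_of_lt_one hθ0.le hθ1).const_mul k
    filter_upwards [hlim₁.eventually_lt_const hr₀, hlim₂.eventually_lt_const one_pos]
      with n hn₁ hn₂
    have hratio : 2 * d * (u * θ) ^ n / (4 * (c * u ^ n)) = k * θ ^ n := by
      rw [hk, mul_pow]
      field_simp
      ring
    have h := measure_near_ratPoint_le hd hdbl hdec (N := 2 ^ (n + 1)) (ρ := c * u ^ n)
      (η := ((2 : ℝ) ^ (-τ)) ^ n) (ε := 2 * d * (u * θ) ^ n) (by positivity) hn₁ (by positivity)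
      (by
        rw [← huθ]
        have : 0 < d * (u * θ) ^ n := by positivity
        linarith)
      (by
        rw [← div_le_one (by positivity), hratio]
        exact hn₂.le)
      (by
        calc d.factorial * (16 * (c * u ^ n)) ^ d * (2 ^ (n + 1)) ^ (d + 1)
            = d.factorial * (16 * c) ^ d * 2 ^ (d + 1) * (u ^ d * 2 ^ (d + 1)) ^ n := by ring
          _ < 1 := by rwa [hud, one_pow, mul_one])
    rw [hratio, Real.mul_rpow hk0.le (by positivity), ← Real.rpow_natCast θ n,
      ← Real.rpow_mul hθ0.le, mul_comm (n : ℝ), Real.rpow_mul hθ0.le, Real.rpow_natCast,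
      ← mul_assoc C, mul_assoc] at h
    exact h
  obtain ⟨n₀, hn₀⟩ := Filter.eventually_atTop.1 hbound
  have hsum : Summable fun n => C * k ^ α * (θ ^ α) ^ n :=
    (summable_geometric_of_lt_one (by positivity)
      (Real.rpow_lt_one hθ0.le hθ1 hα)).mul_left _
  have hfin : ∑' n, μ (E (n + n₀)) ≠ ⊤ := by
    refine ne_top_of_le_ne_top ?_
      (ENNReal.tsum_le_tsum fun n => hn₀ (n + n₀) (Nat.le_add_left _ _))
    rw [ENNReal.tsum_mul_right]
    refine ENNReal.mul_ne_top ((summable_nat_add_iff n₀).2 hsum).tsum_ofReal_ne_top ?_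
    finiteness
  refine measure_mono_null ?_ (measure_setOfPred_frequently_eq_zero (p := fun n y => y ∈ E (n + n₀))
    hfin)
  rintro x ⟨hxK, hx⟩
  have hfreq := frequently_of_mem_wellApprox hτ0 hx
  rw [← Filter.map_add_atTop_eq_nat n₀, Filter.frequently_map] at hfreq
  exact hfreq.mono fun n hn => ⟨hxK, hn⟩
end
end
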